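/- arXiv:1902.04197 — 2 statements merged into one kernel-verified Lean document; each statement's English description precedes it below -/
import Mathlib

section
/- Let ρ₀ be a Borel probability measure on ℝ with finite second moment and v₀: ℝ → ℝ absolutely continuous. Then there exists a Lipschitz continuous map X: [0,∞) → L²(ρ₀), admitting for each t ≥ 0 a continuous representative X(·,t): ℝ → ℝ, which satisfies X(0) = id_ℝ ρ₀-almost everywhere and the Euler–Poisson flow equation, and which moreover has the following properties: (i) for Lebesgue-almost every s, t ∈ [0,∞) with s ≤ t, E(t) ≤ E(s), where E(τ) := ∫ ½ Ẋ(τ)² dρ₀ + ∫∫ ½ |X(y,τ) − X(z,τ)| dρ₀(y) dρ₀(z); (ii) for every t ≥ 0 and all y, z ∈ supp(ρ₀) with y ≥ z, 0 ≤ X(y,t) − X(z,t) ≤ (y − z) + t ∫_z^y |v₀'(x)| dx; (iii) for all 0 < s ≤ t and all y, z ∈ supp(ρ₀), (1/t)|X(y,t) − X(z,t)| ≤ (1/s)|X(y,s) − X(z,s)|. -/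
open MeasureTheory Real Filter Set Topology

noncomputable section


/-- The support of a measure, as defined in the paper. -/
def msupp (μ : Measure ℝ) : Set ℝ := {y | ∀ δ > 0, 0 < μ (Ioo (y - δ) (y + δ))}

/-- `X` has strong `L²(ρ)` derivative `V` at time `t`. -/
def HasL2DerivAt (ρ : Measure ℝ) (X : ℝ → ℝ → ℝ) (V : ℝ → ℝ) (t : ℝ) : Prop :=
  Tendsto (fun τ : ℝ => ∫ y, ((X (t + τ) y - X t y) / τ - V y) ^ 2 ∂ρ)
    (𝓝[≠] 0) (𝓝 0)

/-- monotone off a null set -/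
def EPMon (ρ : Measure ℝ) (f : ℝ → ℝ) : Prop := ∃ S ∈ ae ρ, MonotoneOn f S

lemma EPMon.congr {ρ : Measure ℝ} {f g : ℝ → ℝ} (hf : EPMon ρ f) (h : f =ᵐ[ρ] g) :
    EPMon ρ g := by
  obtain ⟨S, hS, hm⟩ := hf
  refine ⟨S ∩ {x | f x = g x}, inter_mem hS h, ?_⟩
  intro x hx y hy hxy
  have := hm hx.1 hy.1 hxy
  rwa [hx.2, hy.2] at this

lemma EPMon.add {ρ : Measure ℝ} {f g : ℝ → ℝ} (hf : EPMon ρ f) (hg : EPMon ρ g) :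
    EPMon ρ (fun x => f x + g x) := by
  obtain ⟨S, hS, hm⟩ := hf
  obtain ⟨S', hS', hm'⟩ := hg
  exact ⟨S ∩ S', inter_mem hS hS', fun x hx y hy hxy =>
    add_le_add (hm hx.1 hy.1 hxy) (hm' hx.2 hy.2 hxy)⟩

lemma EPMon.smul {ρ : Measure ℝ} {f : ℝ → ℝ} (hf : EPMon ρ f) {c : ℝ} (hc : 0 ≤ c) :
    EPMon ρ (fun x => c * f x) := by
  obtain ⟨S, hS, hm⟩ := hf
  exact ⟨S, hS, fun x hx y hy hxy => mul_le_mul_of_nonneg_left (hm hx hy hxy) hc⟩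

lemma EPMon.of_monotone {ρ : Measure ℝ} {f : ℝ → ℝ} (hf : Monotone f) : EPMon ρ f :=
  ⟨univ, univ_mem, hf.monotoneOn _⟩

/-- `X` is the isotonic regression (projection on the monotone cone) of `f`. -/
structure EPIso (ρ : Measure ℝ) (f X : ℝ → ℝ) : Prop where
  mf : MemLp f 2 ρ
  mX : MemLp X 2 ρ
  meas : Measurable X
  mon : EPMon ρ X
  polar : ∀ k, MemLp k 2 ρ → EPMon ρ k → ∫ x, (f x - X x) * k x ∂ρ ≤ 0
  compl : ∫ x, (f x - X x) * X x ∂ρ = 0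

lemma ep_exists_iso (ρ : Measure ℝ) [IsProbabilityMeasure ρ] (f : ℝ → ℝ) (hf : MemLp f 2 ρ) :
    ∃ X, EPIso ρ f X := by
  let K : Set (Lp ℝ 2 ρ) := {k | EPMon ρ k}
  have hK0 : (0 : Lp ℝ 2 ρ) ∈ K := by
    have : EPMon ρ (fun _ => (0:ℝ)) := EPMon.of_monotone monotone_const
    exact this.congr (Lp.coeFn_zero ℝ 2 ρ).symm
  have hKadd : ∀ a ∈ K, ∀ b ∈ K, a + b ∈ K := by
    intro a ha b hb
    exact (EPMon.add ha hb).congr (Lp.coeFn_add a b).symm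
  have hKsmul : ∀ a ∈ K, ∀ c : ℝ, 0 ≤ c → c • a ∈ K := by
    intro a ha c hc
    exact (EPMon.smul ha hc).congr (Lp.coeFn_smul c a).symm
  have hconv : Convex ℝ K := by
    intro a ha b hb s t hs ht _
    exact hKadd _ (hKsmul a ha s hs) _ (hKsmul b hb t ht)
  have hclosed : IsClosed K := by
    apply IsSeqClosed.isClosed
    intro u l hu hl
    obtain ⟨φ, -, hφ⟩ := (tendstoInMeasure_of_tendsto_Lp hl).exists_seq_tendsto_ae
    choose S hS hm using hu
    refine ⟨(⋂ n, S n) ∩ {x | Tendsto (fun i => u (φ i) x) atTop (𝓝 (l x))},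
      inter_mem (countable_iInter_mem.2 hS) hφ, ?_⟩
    intro x hx y hy hxy
    have hx1 := mem_iInter.1 hx.1
    have hy1 := mem_iInter.1 hy.1
    exact le_of_tendsto_of_tendsto' hx.2 hy.2 (fun i => hm (φ i) (hx1 _) (hy1 _) hxy)
  obtain ⟨v, hvK, hv⟩ := exists_norm_eq_iInf_of_complete_convex ⟨0, hK0⟩ hclosed.isComplete hconv
    (hf.toLp f)
  rw [norm_eq_iInf_iff_real_inner_le_zero hconv hvK] at hv
  have hpol : ∀ k ∈ K, inner ℝ (hf.toLp f - v) k ≤ 0 := by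
    intro k hk
    simpa using hv _ (hKadd _ hvK _ hk)
  have hcomp : inner ℝ (hf.toLp f - v) v = 0 := by
    apply le_antisymm (hpol v hvK)
    simpa using hv 0 hK0
  have hvm : MemLp v 2 ρ := Lp.memLp v
  let X : ℝ → ℝ := hvm.1.mk v
  have hX : v =ᵐ[ρ] X := hvm.1.ae_eq_mk
  have key : ∀ k : Lp ℝ 2 ρ, ∀ k' : ℝ → ℝ, k =ᵐ[ρ] k' →
      inner ℝ (hf.toLp f - v) k = ∫ x, (f x - X x) * k' x ∂ρ := by
    intro k k' hk
    rw [L2.inner_def]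
    apply integral_congr_ae
    filter_upwards [hX, hk, Lp.coeFn_sub (hf.toLp f) v, hf.coeFn_toLp] with x h1 h2 h3 h4
    rw [h3, h2, Pi.sub_apply, h1, h4]
    simp [mul_comm]
  refine ⟨X, hf, hvm.ae_eq hX, hvm.1.stronglyMeasurable_mk.measurable, hvK.congr hX, ?_, ?_⟩
  · intro k hk hkm
    rw [← key (hk.toLp k) k hk.coeFn_toLp]
    exact hpol _ (hkm.congr hk.coeFn_toLp.symm)
  · rw [← key v X hX, hcomp]

namespace EPIso
set_option linter.unusedSectionVars false
variable {ρ : Measure ℝ} [IsProbabilityMeasure ρ] {f X : ℝ → ℝ}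

lemma memξ (h : EPIso ρ f X) : MemLp (fun x => f x - X x) 2 ρ := h.mf.sub h.mX

lemma intξ (h : EPIso ρ f X) : Integrable (fun x => f x - X x) ρ :=
  h.memξ.integrable (by norm_num)

/-- nonpositive over upper sets -/
lemma upper (h : EPIso ρ f X) {U S : Set ℝ} (hU : MeasurableSet U) (hS : S ∈ ae ρ)
    (hup : ∀ x ∈ S, x ∈ U → ∀ y ∈ S, x ≤ y → y ∈ U) : ∫ x in U, (f x - X x) ∂ρ ≤ 0 := by
  have h1 := h.polar (U.indicator 1) ((memLp_const 1).indicator hU) ⟨S, hS, ?_⟩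
  · rw [← integral_indicator hU]
    refine le_of_eq_of_le (integral_congr_ae (ae_of_all _ fun x => ?_)) h1
    by_cases hx : x ∈ U <;> simp [hx]
  · intro x hx y hy hxy
    by_cases hxU : x ∈ U
    · simp [hxU, hup x hx hxU y hy hxy]
    · simp only [hxU, not_false_eq_true, indicator_of_notMem]
      exact indicator_nonneg (fun _ _ => zero_le_one) _

lemma total (h : EPIso ρ f X) : ∫ x, (f x - X x) ∂ρ = 0 := by
  have h1 := h.polar (fun _ => 1) (memLp_const 1) (EPMon.of_monotone monotone_const)
  have h2 := h.polar (fun _ => -1) (memLp_const (-1)) (EPMon.of_monotone monotone_const)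
  simp only [mul_one, mul_neg, integral_neg] at h1 h2
  linarith

lemma comp_zero (h : EPIso ρ f X) {p : ℝ → ℝ} (hp : Monotone p) (hp' : Monotone (fun x => x - p x))
    (hm : MemLp (fun x => p (X x)) 2 ρ) : ∫ x, (f x - X x) * p (X x) ∂ρ = 0 := by
  obtain ⟨S, hS, hmon⟩ := h.mon
  have h1 := h.polar (fun x => p (X x)) hm ⟨S, hS, fun x hx y hy hxy => hp (hmon hx hy hxy)⟩
  have h2 := h.polar (fun x => X x - p (X x)) (h.mX.sub hm)
    ⟨S, hS, fun x hx y hy hxy => hp' (hmon hx hy hxy)⟩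
  have h3 : ∫ x, (f x - X x) * (X x - p (X x)) ∂ρ =
      ∫ x, (f x - X x) * X x ∂ρ - ∫ x, (f x - X x) * p (X x) ∂ρ := by
    have i1 : Integrable (fun x => (f x - X x) * X x) ρ := h.memξ.integrable_mul h.mX
    have i2 : Integrable (fun x => (f x - X x) * p (X x)) ρ := h.memξ.integrable_mul hm
    rw [← integral_sub i1 i2]
    congr 1; ext x; ring
  rw [h3, h.compl] at h2
  linarith

end EPIso

/-- π-λ step -/
lemma ep_borel_zero {ρ : Measure ℝ} [IsProbabilityMeasure ρ] {ξ X : ℝ → ℝ} (hX : Measurable X)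
    (hξ : Integrable ξ ρ) (h0 : ∫ x, ξ x ∂ρ = 0)
    (hc : ∀ c, ∫ x in X ⁻¹' (Ici c), ξ x ∂ρ = 0) (B : Set ℝ) (hB : MeasurableSet B) :
    ∫ x in X ⁻¹' B, ξ x ∂ρ = 0 := by
  have hgen : (inferInstance : MeasurableSpace ℝ) = MeasurableSpace.generateFrom (range Ici) := by
    rw [← borel_eq_generateFrom_Ici]; exact BorelSpace.measurable_eq
  refine MeasurableSpace.induction_on_inter
    (C := fun B _ => ∫ x in X ⁻¹' B, ξ x ∂ρ = 0) hgen ?_ ?_ ?_ ?_ ?_ B hB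
  · rw [← image_univ]; exact isPiSystem_image_Ici univ
  · simp
  · rintro _ ⟨c, rfl⟩; exact hc c
  · intro t ht h
    rw [preimage_compl, setIntegral_compl (hX ht) hξ, h, h0]; simp
  · intro g hd hm h
    rw [preimage_iUnion, integral_iUnion (fun i => hX (hm i)) ?_ hξ.integrableOn]
    · simp [h]
    · intro i j hij
      exact (hd hij).preimage X

lemma EPIso.borel {ρ : Measure ℝ} [IsProbabilityMeasure ρ] {f X : ℝ → ℝ}
    (h : EPIso ρ f X) (B : Set ℝ) (hB : MeasurableSet B) :
    ∫ x in X ⁻¹' B, (f x - X x) ∂ρ = 0 := by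
  refine ep_borel_zero h.meas h.intξ h.total (fun c => ?_) B hB
  let q : ℕ → ℝ → ℝ := fun n x => max 0 (min (1 / ((n:ℝ) + 1)) (x - c + 1 / ((n:ℝ) + 1)))
  have hq0 : ∀ n x, 0 ≤ q n x := fun n x => le_max_left _ _
  have hpos : ∀ n : ℕ, 0 < 1 / ((n:ℝ) + 1) := fun n => by positivity
  have hq1 : ∀ n x, q n x ≤ 1 / ((n:ℝ) + 1) := fun n x =>
    max_le (hpos n).le (min_le_left _ _)
  have hqm : ∀ n, Measurable (q n) := fun n => by fun_prop
  have hz : ∀ n : ℕ, ∫ x, (f x - X x) * (((n:ℝ) + 1) * q n (X x)) ∂ρ = 0 := by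
    intro n
    have := h.comp_zero (p := q n) ?_ ?_ ?_
    · rw [← mul_zero ((n:ℝ) + 1), ← this, ← integral_const_mul]
      congr 1; ext x; ring
    · intro x y hxy
      simp only [q]; gcongr
    · intro x y hxy
      simp only [q]
      rcases max_cases (0:ℝ) (min (1 / ((n:ℝ) + 1)) (x - c + 1 / ((n:ℝ) + 1))) with h1 | h1 <;>
      rcases max_cases (0:ℝ) (min (1 / ((n:ℝ) + 1)) (y - c + 1 / ((n:ℝ) + 1))) with h2 | h2 <;>
      rcases min_cases (1 / ((n:ℝ) + 1)) (x - c + 1 / ((n:ℝ) + 1)) with h3 | h3 <;>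
      rcases min_cases (1 / ((n:ℝ) + 1)) (y - c + 1 / ((n:ℝ) + 1)) with h4 | h4 <;>
      rw [h1.1, h2.1] <;> linarith [hpos n]
    · refine MemLp.of_bound ((hqm n).comp h.meas).aestronglyMeasurable (1 / ((n:ℝ) + 1))
        (ae_of_all _ fun x => ?_)
      rw [Real.norm_of_nonneg (hq0 _ _)]; exact hq1 _ _
  have hlim : Tendsto (fun n : ℕ => ∫ x, (f x - X x) * (((n:ℝ) + 1) * q n (X x)) ∂ρ) atTop
      (𝓝 (∫ x, (X ⁻¹' (Ici c)).indicator (fun x => f x - X x) x ∂ρ)) := by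
    apply tendsto_integral_of_dominated_convergence (fun x => |f x - X x|)
    · intro n
      exact h.intξ.1.mul (((hqm n).comp h.meas).const_mul _).aestronglyMeasurable
    · exact h.intξ.abs
    · intro n
      refine ae_of_all _ fun x => ?_
      have h1 : ((n:ℝ) + 1) * q n (X x) ≤ 1 := by
        have := mul_le_mul_of_nonneg_left (hq1 n (X x)) (by positivity : 0 ≤ (n:ℝ) + 1)
        rwa [mul_one_div_cancel (by positivity)] at this
      rw [Real.norm_eq_abs, abs_mul, abs_of_nonneg (mul_nonneg (by positivity) (hq0 n (X x)))]
      exact mul_le_of_le_one_right (abs_nonneg _) h1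
    · refine ae_of_all _ fun x => ?_
      by_cases hx : c ≤ X x
      · have : x ∈ X ⁻¹' (Ici c) := hx
        rw [indicator_of_mem this]
        apply tendsto_const_nhds.congr
        intro n
        have : q n (X x) = 1 / ((n:ℝ) + 1) := by
          simp only [q]
          rw [min_eq_left (by linarith), max_eq_right (hpos n).le]
        rw [this, mul_one_div_cancel (by positivity), mul_one]
      · have : x ∉ X ⁻¹' (Ici c) := hx
        rw [indicator_of_notMem this]
        push Not at hx
        have hev : ∀ᶠ n : ℕ in atTop, 1 / ((n:ℝ) + 1) < c - X x :=
          (tendsto_one_div_add_atTop_nhds_zero_nat).eventually_lt_const (by linarith)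
        refine tendsto_const_nhds.congr' ?_
        filter_upwards [hev] with n hn
        have : q n (X x) = 0 := by
          simp only [q]
          rw [min_eq_right (by linarith), max_eq_left (by linarith)]
        rw [this]; simp
  simp only [hz] at hlim
  rw [← integral_indicator (h.meas measurableSet_Ici)]
  exact (tendsto_nhds_unique hlim tendsto_const_nhds)


lemma ep_good {ρ : Measure ℝ} [IsProbabilityMeasure ρ] {J : ℝ → ℝ} (hJ : Measurable J) :
    ∀ᵐ z ∂ρ, ∀ ε > 0, 0 < ρ {x | J z ≤ J x ∧ J x < J z + ε} := by
  set μ := ρ.map J with hμ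
  have key : ∀ᵐ j ∂μ, ∀ ε > 0, 0 < μ (Ico j (j + ε)) := by
    set T : Set ℝ := {j | j ∈ μ.support ∧ 𝓝[μ.support ∩ Ioi j] j = ⊥}
    have hT : T.Countable := countable_setOfPred_isolated_right_within
    have h2 : μ (⋃ j ∈ {j ∈ T | μ {j} = 0}, {j}) = 0 :=
      (measure_biUnion_null_iff (hT.mono (sep_subset _ _))).2 (fun j hj => hj.2)
    have h1 : μ.support ∈ ae μ := Measure.support_mem_ae
    have h3 : ∀ᵐ j ∂μ, j ∉ (⋃ j ∈ {j ∈ T | μ {j} = 0}, {j}) := measure_eq_zero_iff_ae_notMem.1 h2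
    filter_upwards [h1, h3] with j hj1 hj3 ε hε
    rw [pos_iff_ne_zero]
    intro h0
    apply hj3
    simp only [mem_iUnion, mem_singleton_iff, exists_prop, exists_eq_right']
    refine ⟨⟨hj1, ?_⟩, measure_mono_null (by intro x hx; simp at hx; subst hx; simp [hε]) h0⟩
    have : Ioo j (j + ε) ∩ μ.support = ∅ := by
      by_contra hne
      obtain ⟨x, hx, hxs⟩ := nonempty_iff_ne_empty.2 hne
      have := (Measure.mem_support_iff_forall x).1 hxs (Ioo j (j + ε)) (isOpen_Ioo.mem_nhds hx)
      exact this.ne' (measure_mono_null Ioo_subset_Ico_self h0)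
    rw [← empty_mem_iff_bot, mem_nhdsWithin]
    refine ⟨Iio (j + ε), isOpen_Iio, by simp [hε], ?_⟩
    intro x hx
    rw [← this]
    exact ⟨⟨hx.2.2, hx.1⟩, hx.2.1⟩
  have := ae_of_ae_map hJ.aemeasurable key
  filter_upwards [this] with z hz ε hε
  have := hz ε hε
  rwa [hμ, Measure.map_apply hJ measurableSet_Ico] at this

lemma ep_extract {ρ : Measure ℝ} [IsProbabilityMeasure ρ] {h : ℝ → ℝ} (hh : Integrable h ρ)
    {A G S : Set ℝ} (hA : MeasurableSet A) (hG : 0 < ρ G) (hS : S ∈ ae ρ)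
    (hsub : ∀ x ∈ S, x ∈ G → x ∈ A) (hint : ∫ x in A, h x ∂ρ ≤ 0) :
    ∃ x ∈ S, x ∈ A ∧ h x ≤ 0 := by
  by_contra! hc
  have h0 : 0 ≤ᵐ[ρ.restrict A] h := by
    rw [EventuallyLE, ae_restrict_iff' hA]
    filter_upwards [hS] with x hx hxA using (hc x hx hxA).le
  have h1 : 0 < ρ (Function.support h ∩ A) := by
    refine lt_of_lt_of_le hG ?_
    calc ρ G = ρ (G ∩ S) := (measure_inter_conull hS).symm
      _ ≤ ρ (Function.support h ∩ A) := measure_mono (fun x hx => ⟨(hc x hx.2 (hsub x hx.2 hx.1)).ne', hsub x hx.2 hx.1⟩)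
  have := (setIntegral_pos_iff_support_of_nonneg_ae h0 hh.integrableOn).2 h1
  linarith

lemma ep_gap {ρ : Measure ℝ} [IsProbabilityMeasure ρ] {f X Z ζ : ℝ → ℝ}
    (hX : EPIso ρ f X) (hZm : Measurable Z) (hζ : Integrable ζ ρ)
    (hζZ : ∀ B, MeasurableSet B → ∫ x in Z ⁻¹' B, ζ x ∂ρ = 0)
    (hζX : ∀ B, MeasurableSet B → ∫ x in X ⁻¹' B, ζ x ∂ρ = 0)
    (hZ : EPMon ρ Z) (hw : EPMon ρ (fun x => Z x - f x + ζ x)) :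
    ∃ S ∈ ae ρ, ∀ y ∈ S, ∀ z ∈ S, z ≤ y → 0 ≤ X y - X z ∧ X y - X z ≤ Z y - Z z := by
  obtain ⟨S1, hS1, hmX⟩ := hX.mon
  obtain ⟨S2, hS2, hmZ⟩ := hZ
  obtain ⟨S3, hS3, hmw⟩ := hw
  set J : ℝ → ℝ := fun x => X x + x with hJdef
  have hJ : Measurable J := hX.meas.add measurable_id
  have hg1 := ep_good (ρ := ρ) hJ
  have hg2 := ep_good (ρ := ρ) hJ.neg
  set S0 := S1 ∩ S2 ∩ S3 with hS0
  have hS0ae : S0 ∈ ae ρ := inter_mem (inter_mem hS1 hS2) hS3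
  refine ⟨S0 ∩ ({z | ∀ ε > 0, 0 < ρ {x | J z ≤ J x ∧ J x < J z + ε}} ∩
    {z | ∀ ε > 0, 0 < ρ {x | (-J) z ≤ (-J) x ∧ (-J) x < (-J) z + ε}}),
    inter_mem hS0ae (inter_mem hg1 hg2), ?_⟩
  rintro y ⟨hy, -, hyg⟩ z ⟨hz, hzg, -⟩ hzy
  have hm : ∀ x ∈ S0, ∀ x' ∈ S0, x ≤ x' → X x ≤ X x' ∧ Z x ≤ Z x' ∧
      Z x - f x + ζ x ≤ Z x' - f x' + ζ x' := fun x hx x' hx' h =>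
    ⟨hmX hx.1.1 hx'.1.1 h, hmZ hx.1.2 hx'.1.2 h, hmw hx.2 hx'.2 h⟩
  obtain ⟨hX1, hZ1, -⟩ := hm z hz y hy hzy
  refine ⟨by linarith, ?_⟩
  rcases hX1.eq_or_lt with heq | hlt
  · linarith
  apply le_of_forall_pos_le_add
  intro e he
  set ε := min (e / 2) ((X y - X z) / 2) with hε
  have hε0 : 0 < ε := lt_min (by linarith) (by linarith)
  have hε1 : ε ≤ e / 2 := min_le_left _ _
  have hε2 : ε ≤ (X y - X z) / 2 := min_le_right _ _
  set h : ℝ → ℝ := fun x => (f x - X x) - ζ x with hh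
  have hhi : Integrable h ρ := hX.intξ.sub hζ
  have hsplit : ∀ A, MeasurableSet A → ∫ x in A, h x ∂ρ =
      ∫ x in A, (f x - X x) ∂ρ - ∫ x in A, ζ x ∂ρ := fun A _ =>
    integral_sub hX.intξ.integrableOn hζ.integrableOn
  have hdiff : ∀ A B, MeasurableSet A → MeasurableSet B → (∀ x ∈ S0, x ∈ B → x ∈ A) →
      ∫ x in A \ B, h x ∂ρ = ∫ x in A, h x ∂ρ - ∫ x in B, h x ∂ρ := by
    intro A B hA hB hAB
    have e1 : (A ∩ B : Set ℝ) =ᵐ[ρ] B := by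
      filter_upwards [hS0ae] with x hx
      exact propext ⟨fun h => h.2, fun h => ⟨hAB x hx h, h⟩⟩
    have := integral_inter_add_sdiff (μ := ρ) (f := h) (s := A) hB hhi.integrableOn
    rw [setIntegral_congr_set e1] at this
    linarith
  -- low point
  have hP : MeasurableSet (Z ⁻¹' (Ici (Z z))) := hZm measurableSet_Ici
  have hQ : MeasurableSet (X ⁻¹' (Ici (X z + ε))) := hX.meas measurableSet_Ici
  obtain ⟨x, hxS, hxA, hx⟩ : ∃ x ∈ S0, x ∈ Z ⁻¹' (Ici (Z z)) \ X ⁻¹' (Ici (X z + ε)) ∧ h x ≤ 0 := by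
    refine ep_extract hhi (hP.diff hQ) (hzg ε hε0) hS0ae ?_ ?_
    · rintro x hx ⟨hx1, hx2⟩
      simp only [hJdef] at hx1 hx2
      have hzx : z ≤ x := by
        by_contra! hlt'
        have := (hm x hx z hz hlt'.le).1
        linarith
      refine ⟨(hm z hz x hx hzx).2.1, ?_⟩
      simp only [mem_preimage, mem_Ici, not_le]
      linarith
    · rw [hdiff _ _ hP hQ, hsplit _ hP, hsplit _ hQ, hζZ _ measurableSet_Ici,
        hζX _ measurableSet_Ici, hX.borel _ measurableSet_Ici]
      · have := hX.upper hP hS0ae (fun a ha haU b hb hab =>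
          le_trans (mem_Ici.1 haU) (hm a ha b hb hab).2.1)
        linarith
      · intro x hx hxB
        simp only [mem_preimage, mem_Ici] at hxB ⊢
        have hzx : z ≤ x := by
          by_contra! hlt'
          have := (hm x hx z hz hlt'.le).1
          linarith
        exact (hm z hz x hx hzx).2.1
  have hP' : MeasurableSet (X ⁻¹' (Ioi (X y - ε))) := hX.meas measurableSet_Ioi
  have hQ' : MeasurableSet (Z ⁻¹' (Ioi (Z y))) := hZm measurableSet_Ioi
  obtain ⟨x', hxS', hxA', hx'⟩ : ∃ x ∈ S0, x ∈ X ⁻¹' (Ioi (X y - ε)) \ Z ⁻¹' (Ioi (Z y)) ∧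
      -h x ≤ 0 := by
    refine ep_extract hhi.neg (hP'.diff hQ') (hyg ε hε0) hS0ae ?_ ?_
    · rintro x hx ⟨hx1, hx2⟩
      simp only [hJdef, Pi.neg_apply] at hx1 hx2
      have hzx : x ≤ y := by
        by_contra! hlt'
        have := (hm y hy x hx hlt'.le).1
        linarith
      refine ⟨?_, ?_⟩
      · simp only [mem_preimage, mem_Ioi]
        linarith
      · simp only [mem_preimage, mem_Ioi, not_lt]
        exact (hm x hx y hy hzx).2.1
    · simp only [Pi.neg_apply]
      rw [integral_neg, hdiff _ _ hP' hQ', hsplit _ hP', hsplit _ hQ', hζZ _ measurableSet_Ioi,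
        hζX _ measurableSet_Ioi, hX.borel _ measurableSet_Ioi]
      · have := hX.upper hQ' hS0ae (fun a ha haU b hb hab =>
          lt_of_lt_of_le (mem_Ioi.1 haU) (hm a ha b hb hab).2.1)
        linarith
      · intro x hx hxB
        simp only [mem_preimage, mem_Ioi] at hxB ⊢
        have hzx : y ≤ x := by
          by_contra! hlt'
          have := (hm x hx y hy hlt'.le).2.1
          linarith
        have := (hm y hy x hx hzx).1
        linarith
  obtain ⟨a1, a2⟩ := hxA
  obtain ⟨b1, b2⟩ := hxA'
  simp only [mem_preimage, mem_Ici, mem_Ioi, not_le, not_lt] at a1 a2 b1 b2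
  have hxx : x ≤ x' := by
    by_contra! hlt'
    have := (hm x' hxS' x hxS hlt'.le).1
    linarith
  have := (hm x hxS x' hxS' hxx).2.2
  simp only [hh] at hx hx'
  linarith

/-- stickiness: the residual of the regression of `F` is orthogonal to the level sets
of the regression of `f` whenever `F - f` is monotone -/
lemma ep_stick {ρ : Measure ℝ} [IsProbabilityMeasure ρ] {f X F Z : ℝ → ℝ}
    (hX : EPIso ρ f X) (hZ : EPIso ρ F Z) (hw : EPMon ρ (fun x => F x - f x))
    (B : Set ℝ) (hB : MeasurableSet B) : ∫ x in X ⁻¹' B, (F x - Z x) ∂ρ = 0 := by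
  refine ep_borel_zero hX.meas hZ.intξ hZ.total (fun c => ?_) B hB
  obtain ⟨S1, hS1, hmX⟩ := hX.mon
  obtain ⟨S2, hS2, hmZ⟩ := hZ.mon
  obtain ⟨S3, hS3, hmw⟩ := hw
  set S := S1 ∩ S2 ∩ S3 with hS0
  have hS : S ∈ ae ρ := inter_mem (inter_mem hS1 hS2) hS3
  have hm : ∀ x ∈ S, ∀ x' ∈ S, x ≤ x' → X x ≤ X x' ∧ Z x ≤ Z x' ∧
      F x - f x ≤ F x' - f x' := fun x hx x' hx' h =>
    ⟨hmX hx.1.1 hx'.1.1 h, hmZ hx.1.2 hx'.1.2 h, hmw hx.2 hx'.2 h⟩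
  set U : Set ℝ := X ⁻¹' (Ici c) with hUdef
  have hU : MeasurableSet U := hX.meas measurableSet_Ici
  have hUup : ∀ x ∈ S, x ∈ U → ∀ y ∈ S, x ≤ y → y ∈ U := fun a ha haU b hb hab =>
    le_trans (mem_Ici.1 haU) (hm a ha b hb hab).1
  apply le_antisymm (hZ.upper hU hS hUup)
  by_cases hne1 : ∃ x0 ∈ S, x0 ∉ U
  swap
  · push Not at hne1
    have : U =ᵐ[ρ] (univ : Set ℝ) := by
      filter_upwards [hS] with x hx
      exact propext ⟨fun _ => trivial, fun _ => hne1 x hx⟩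
    rw [setIntegral_congr_set this, setIntegral_univ, hZ.total]
  by_cases hne2 : ∃ x1 ∈ S, x1 ∈ U
  swap
  · push Not at hne2
    have : U =ᵐ[ρ] (∅ : Set ℝ) := by
      filter_upwards [hS] with x hx
      exact propext ⟨fun h => hne2 x hx h, fun h => h.elim⟩
    rw [setIntegral_congr_set this]; simp
  obtain ⟨x0, hx0, hx0U⟩ := hne1
  obtain ⟨x1, hx1, hx1U⟩ := hne2
  have hlt : ∀ x ∈ S, x ∉ U → ∀ y ∈ S, y ∈ U → x ≤ y := by
    intro x hx hxU y hy hyU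
    by_contra! h
    exact hxU (hUup y hy hyU x hx h.le)
  set ζ := sInf (Z '' (U ∩ S)) with hζ
  have hbdd : BddBelow (Z '' (U ∩ S)) := by
    refine ⟨Z x0, ?_⟩
    rintro _ ⟨x, hx, rfl⟩
    exact (hm x0 hx0 x hx.2 (hlt x0 hx0 hx0U x hx.2 hx.1)).2.1
  have hge : ∀ x ∈ S, x ∈ U → ζ ≤ Z x := fun x hx hxU => csInf_le hbdd ⟨x, ⟨hxU, hx⟩, rfl⟩
  have hle : ∀ x ∈ S, x ∉ U → Z x ≤ ζ := by
    intro x hx hxU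
    refine le_csInf (⟨Z x1, x1, ⟨hx1U, hx1⟩, rfl⟩ : (Z '' (U ∩ S)).Nonempty) ?_
    rintro _ ⟨y, hy, rfl⟩
    exact (hm x hx y hy.2 (hlt x hx hxU y hy.2 hy.1)).2.1
  -- d = (f - X) - (F - Z) = Z - X - (F - f)
  set d : ℝ → ℝ := fun x => (f x - X x) - (F x - Z x) with hd
  have hdi : Integrable d ρ := hX.intξ.sub hZ.intξ
  have hsplit : ∀ A : Set ℝ, ∫ x in A, d x ∂ρ =
      ∫ x in A, (f x - X x) ∂ρ - ∫ x in A, (F x - Z x) ∂ρ := fun A =>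
    integral_sub hX.intξ.integrableOn hZ.intξ.integrableOn
  suffices hmain : ∫ x in U, d x ∂ρ ≤ 0 by
    rw [hsplit, hX.borel _ measurableSet_Ici] at hmain
    linarith
  have hA1 : MeasurableSet (Z ⁻¹' (Ici ζ)) := hZ.meas measurableSet_Ici
  have hA2 : MeasurableSet (Z ⁻¹' (Ioi ζ)) := hZ.meas measurableSet_Ioi
  have hI1 : ∫ x in Z ⁻¹' (Ici ζ), d x ∂ρ ≤ 0 := by
    rw [hsplit, hZ.borel _ measurableSet_Ici, sub_zero]
    exact hX.upper hA1 hS (fun a ha haU b hb hab =>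
          le_trans (mem_Ici.1 haU) (hm a ha b hb hab).2.1)
  have hI2 : ∫ x in Z ⁻¹' (Ioi ζ), d x ∂ρ ≤ 0 := by
    rw [hsplit, hZ.borel _ measurableSet_Ioi, sub_zero]
    exact hX.upper hA2 hS (fun a ha haU b hb hab =>
          lt_of_lt_of_le (mem_Ioi.1 haU) (hm a ha b hb hab).2.1)
  have e1 : (Z ⁻¹' (Ici ζ) ∩ U : Set ℝ) =ᵐ[ρ] U := by
    filter_upwards [hS] with x hx
    exact propext ⟨fun h => h.2, fun h => ⟨hge x hx h, h⟩⟩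
  have e2 : (U ∩ Z ⁻¹' (Ioi ζ) : Set ℝ) =ᵐ[ρ] (Z ⁻¹' (Ioi ζ) : Set ℝ) := by
    filter_upwards [hS] with x hx
    refine propext ⟨fun h => h.2, fun h => ⟨?_, h⟩⟩
    by_contra hxU
    exact absurd (hle x hx hxU) (not_le.2 h)
  have s1 := integral_inter_add_sdiff (μ := ρ) (f := d) (s := Z ⁻¹' (Ici ζ)) hU hdi.integrableOn
  have s2 := integral_inter_add_sdiff (μ := ρ) (f := d) (s := U) hA2 hdi.integrableOn
  rw [setIntegral_congr_set e1] at s1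
  rw [setIntegral_congr_set e2] at s2
  by_cases hcase : ∀ x ∈ S, x ∈ U → Z x = ζ → d x ≤ 0
  · have : ∫ x in U \ Z ⁻¹' (Ioi ζ), d x ∂ρ ≤ 0 := by
      apply setIntegral_nonpos_of_ae_restrict
      rw [EventuallyLE, ae_restrict_iff' (hU.diff hA2)]
      filter_upwards [hS] with x hx hxm
      exact hcase x hx hxm.1 (le_antisymm (not_lt.1 hxm.2) (hge x hx hxm.1))
    linarith
  · push Not at hcase
    obtain ⟨p, hpS, hpU, hpζ, hp⟩ := hcase
    have : 0 ≤ ∫ x in Z ⁻¹' (Ici ζ) \ U, d x ∂ρ := by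
      apply setIntegral_nonneg_of_ae_restrict
      rw [EventuallyLE, ae_restrict_iff' (hA1.diff hU)]
      filter_upwards [hS] with x hx hxm
      have h1 : Z x = ζ := le_antisymm (hle x hx hxm.2) hxm.1
      have := hm x hx p hpS (hlt x hx hxm.2 p hpS hpU)
      simp only [hd] at hp ⊢
      simp only [Pi.zero_apply]
      linarith
    linarith


lemma ep_partition {h g : ℝ → ℝ} {a b : ℝ} (hab : a ≤ b)
    (H : ∀ ε > 0, ∃ A B : ℝ, ∀ s t, a ≤ s → s ≤ t → t ≤ b →
      h t - h s ≤ ε * (t - s) + A * (t - s) * (g s - g t) + B * (t - s) ^ 2) : h b ≤ h a := by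
  have key : ∀ ε > 0, h b - h a ≤ ε * (b - a) := by
    intro ε hε
    obtain ⟨A, B, hAB⟩ := H ε hε
    have hn : ∀ n : ℕ, h b - h a ≤ ε * (b - a) +
        (A * (b - a) * (g a - g b) + B * (b - a) ^ 2) * (1 / ((n:ℝ) + 1)) := by
      intro n
      set δ := (b - a) / ((n:ℝ) + 1) with hδ
      have hn0 : (0:ℝ) < (n:ℝ) + 1 := by positivity
      have hδ0 : 0 ≤ δ := div_nonneg (by linarith) hn0.le
      have hδn : ((n:ℝ) + 1) * δ = b - a := by rw [hδ]; field_simp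
      have ind : ∀ k : ℕ, k ≤ n + 1 → h (a + k * δ) - h a ≤ ε * (k * δ) +
          A * δ * (g a - g (a + k * δ)) + B * δ ^ 2 * k := by
        intro k
        induction k with
        | zero => intro _; simp
        | succ k ih =>
          intro hk
          have i1 := ih (by omega)
          have hk' : (k:ℝ) + 1 ≤ (n:ℝ) + 1 := by exact_mod_cast hk
          have i2 := hAB (a + k * δ) (a + (k + 1) * δ) (by nlinarith [mul_nonneg (Nat.cast_nonneg (α := ℝ) k) hδ0])
            (by nlinarith) (by nlinarith)
          have e : a + ((k:ℝ) + 1) * δ - (a + k * δ) = δ := by ring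
          rw [e] at i2
          push_cast
          linarith
      have := ind (n + 1) le_rfl
      push_cast at this
      rw [hδn] at this
      have e : a + (b - a) = b := by ring
      rw [e] at this
      have e1 : A * δ * (g a - g b) = A * (b - a) * (g a - g b) * (1 / ((n:ℝ) + 1)) := by
        rw [hδ]; ring
      have e2 : B * δ ^ 2 * ((n:ℝ) + 1) = B * (b - a) ^ 2 * (1 / ((n:ℝ) + 1)) := by
        rw [hδ]; field_simp
      rw [e1, e2] at this
      linarith
    have hl : Tendsto (fun n : ℕ => ε * (b - a) +
        (A * (b - a) * (g a - g b) + B * (b - a) ^ 2) * (1 / ((n:ℝ) + 1))) atTop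
        (𝓝 (ε * (b - a) + (A * (b - a) * (g a - g b) + B * (b - a) ^ 2) * 0)) :=
      (tendsto_one_div_add_atTop_nhds_zero_nat.const_mul _).const_add _
    have := ge_of_tendsto' hl hn
    simpa using this
  have : h b - h a ≤ 0 := by
    have hl : Tendsto (fun n : ℕ => (1 / ((n:ℝ) + 1)) * (b - a)) atTop (𝓝 (0 * (b - a))) :=
      tendsto_one_div_add_atTop_nhds_zero_nat.mul_const _
    have := ge_of_tendsto' hl (fun n => key _ (by positivity))
    simpa using this
  linarith

/-- abstract data of the flow in a Hilbert space -/
structure EPFlow {H : Type*} [NormedAddCommGroup H] [InnerProductSpace ℝ H]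
    (Y X : ℝ → H) (e v F : H) (E : ℝ → H →L[ℝ] H) : Prop where
  hYdef : ∀ t, Y t = e + t • v - (t ^ 2 / 2) • F
  sym : ∀ t, 0 ≤ t → ∀ a b, inner ℝ (E t a) b = inner ℝ a (E t b)
  c1 : ∀ s t, 0 ≤ s → s ≤ t → ∀ a, E t (E s a) = E t a
  c2 : ∀ s t, 0 ≤ s → s ≤ t → ∀ a, E s (E t a) = E t a
  hX : ∀ t, 0 ≤ t → E t (X t) = X t
  hY : ∀ t, 0 ≤ t → E t (Y t) = X t
  pol : ∀ s t, 0 ≤ s → 0 ≤ t → inner ℝ (Y t - X t) (X s) ≤ 0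
  pos : ∀ t, 0 ≤ t → 0 ≤ inner ℝ (X t) F

namespace EPFlow
variable {H : Type*} [NormedAddCommGroup H] [InnerProductSpace ℝ H]
    {Y X : ℝ → H} {e v F : H} {E : ℝ → H →L[ℝ] H}

/-- velocity -/
def V (v F : H) (E : ℝ → H →L[ℝ] H) (t : ℝ) : H := E t (v - t • F)

lemma normE (h : EPFlow Y X e v F E) {t : ℝ} (ht : 0 ≤ t) (a : H) : ‖E t a‖ ≤ ‖a‖ := by
  have h1 : ‖E t a‖ ^ 2 ≤ ‖a‖ * ‖E t a‖ := by
    rw [← real_inner_self_eq_norm_sq, h.sym t ht, h.c1 t t ht le_rfl]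
    exact real_inner_le_norm _ _
  by_contra! hlt
  nlinarith [norm_nonneg a]

lemma diffE (h : EPFlow Y X e v F E) {s t : ℝ} (hs : 0 ≤ s) (hst : s ≤ t) (a : H) :
    ‖E s a - E t a‖ ^ 2 = ‖E s a‖ ^ 2 - ‖E t a‖ ^ 2 := by
  rw [@norm_sub_sq_real]
  have : inner ℝ (E s a) (E t a) = ‖E t a‖ ^ 2 := by
    rw [h.sym s hs, h.c2 s t hs hst, ← real_inner_self_eq_norm_sq, h.sym t (hs.trans hst),
      h.c1 t t (hs.trans hst) le_rfl]
  rw [this]; ring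

lemma main (h : EPFlow Y X e v F E) {s t : ℝ} (hs : 0 ≤ s) (hst : s ≤ t) :
    ‖X t - X s‖ ≤ ‖E s (Y t - Y s)‖ ∧
    ‖X t - X s - E t (Y t - Y s)‖ ≤ ‖E s (Y t - Y s) - E t (Y t - Y s)‖ := by
  have ht := hs.trans hst
  set D := X t - X s with hD
  set R := Y t - Y s with hR
  have hsX : E s (X t) = X t := by rw [← h.hX t ht, h.c2 s t hs hst]
  have hED : E s D = D := by rw [hD, map_sub, hsX, h.hX s hs]
  have o : ∀ r, 0 ≤ r → ∀ a, E r a = a → inner ℝ (Y r - X r) a = 0 := by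
    intro r hr a ha
    rw [← ha, ← h.sym r hr, map_sub, h.hY r hr, h.hX r hr, sub_self, inner_zero_left]
  have h1 : ‖D‖ ^ 2 ≤ inner ℝ R D := by
    have e1 : R - D = (Y t - X t) - (Y s - X s) := by rw [hR, hD]; abel
    have e2 : inner ℝ (R - D) D = - inner ℝ (Y t - X t) (X s) := by
      rw [e1, inner_sub_left, o s hs D hED, hD, inner_sub_right, o t ht (X t) (h.hX t ht)]
      ring
    rw [inner_sub_left, real_inner_self_eq_norm_sq] at e2
    have := h.pol s t hs ht
    linarith
  have h2 : inner ℝ R D = inner ℝ (E s R) D := by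
    rw [h.sym s hs, hED]
  have h3 : ‖D‖ ≤ ‖E s R‖ := by
    have := real_inner_le_norm (E s R) D
    by_contra! hlt
    nlinarith [norm_nonneg (E s R)]
  refine ⟨h3, ?_⟩
  have h4 : E t R = E t D := by
    rw [hR, hD, map_sub, map_sub, h.hX t ht, h.hY t ht, ← h.hY s hs, h.c1 s t hs hst]
  have h5 : ‖D - E t D‖ ^ 2 = ‖D‖ ^ 2 - ‖E t D‖ ^ 2 := by
    have := h.diffE hs hst D
    rwa [hED] at this
  have h6 := h.diffE hs hst R
  rw [h4] at h6 ⊢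
  have h7 : ‖D - E t D‖ ^ 2 ≤ ‖E s R - E t D‖ ^ 2 := by
    rw [h5, h6]
    gcongr
  exact (pow_le_pow_iff_left₀ (norm_nonneg _) (norm_nonneg _) two_ne_zero).1 h7

lemma R_eq (h : EPFlow Y X e v F E) (s t : ℝ) :
    Y t - Y s = (t - s) • (v - ((t + s) / 2) • F) := by
  rw [h.hYdef, h.hYdef]
  module

lemma normV (h : EPFlow Y X e v F E) {t b : ℝ} (ht : 0 ≤ t) (htb : t ≤ b) :
    ‖V v F E t‖ ≤ ‖v‖ + b * ‖F‖ := by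
  refine (h.normE ht _).trans ((norm_sub_le _ _).trans ?_)
  rw [norm_smul, Real.norm_of_nonneg ht]
  gcongr

lemma energy (h : EPFlow Y X e v F E) {a b : ℝ} (ha : 0 ≤ a) (hab : a ≤ b) :
    (1/2) * ‖V v F E b‖ ^ 2 + inner ℝ (X b) F ≤ (1/2) * ‖V v F E a‖ ^ 2 + inner ℝ (X a) F := by
  refine ep_partition (h := fun t => (1/2) * ‖V v F E t‖ ^ 2 + inner ℝ (X t) F)
    (g := fun t => (1/2) * ‖V v F E t‖ ^ 2) hab ?_
  intro ε hε
  set m := ‖v‖ + b * ‖F‖ with hm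
  set C := 2 * m * ‖F‖ + b * ‖F‖ ^ 2 with hC
  refine ⟨‖F‖ ^ 2 / (2 * ε), ‖F‖ ^ 2 * C / (4 * ε) + ‖F‖ ^ 2 / 2, ?_⟩
  intro s t has hst htb
  have hs := ha.trans has
  have ht := hs.trans hst
  have hb := ht.trans htb
  set δ := t - s with hδ
  have hδ0 : 0 ≤ δ := by linarith
  have hδb : δ ≤ b := by linarith
  set r := v - ((t + s) / 2) • F with hr
  have m2 := (h.main hs hst).2
  rw [h.R_eq s t, map_smul, map_smul, ← smul_sub, norm_smul, Real.norm_of_nonneg hδ0] at m2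
  change ‖X t - X s - δ • E t r‖ ≤ δ * ‖E s r - E t r‖ at m2
  have hVt : E t r = V v F E t + (δ / 2) • E t F := by
    rw [V, ← map_smul, ← map_add, hr, hδ]; congr 1; module
  have hVs : E s r = V v F E s - (δ / 2) • E s F := by
    rw [V, ← map_smul, ← map_sub, hr, hδ]; congr 1; module
  have iF : ∀ x, 0 ≤ x → inner ℝ (V v F E x) (E x F) = inner ℝ (V v F E x) F := by
    intro x hx
    rw [← h.sym x hx, V, h.c1 x x hx le_rfl]
  -- kinetic
  have k1 : ‖V v F E t + δ • E t F‖ ≤ ‖V v F E s‖ := by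
    have : V v F E t + δ • E t F = E t (V v F E s) := by
      rw [V, V, h.c1 s t hs hst, ← map_smul, ← map_add, hδ]; congr 1; module
    rw [this]; exact h.normE ht _
  have k2 : ‖V v F E t + δ • E t F‖ ^ 2 ≤ ‖V v F E s‖ ^ 2 := by gcongr
  rw [@norm_add_sq_real, inner_smul_right, iF t ht, norm_smul, mul_pow] at k2
  -- q
  have q1 : ‖E s r - E t r‖ ^ 2 ≤ 2 * ((1/2) * ‖V v F E s‖ ^ 2 - (1/2) * ‖V v F E t‖ ^ 2) + C * δ := by
    rw [h.diffE hs hst, hVt, hVs, @norm_add_sq_real, @norm_sub_sq_real, inner_smul_right,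
      inner_smul_right, iF t ht, iF s hs, norm_smul, norm_smul, mul_pow, mul_pow,
      Real.norm_of_nonneg (by positivity : 0 ≤ δ / 2)]
    have a1 : |inner ℝ (V v F E s) F| ≤ m * ‖F‖ := (abs_real_inner_le_norm _ _).trans
      (mul_le_mul_of_nonneg_right (h.normV hs (hst.trans htb)) (norm_nonneg _))
    have a2 : |inner ℝ (V v F E t) F| ≤ m * ‖F‖ := (abs_real_inner_le_norm _ _).trans
      (mul_le_mul_of_nonneg_right (h.normV ht htb) (norm_nonneg _))
    have a3 : ‖E s F‖ ^ 2 ≤ ‖F‖ ^ 2 := by gcongr; exact h.normE hs F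
    have a1' := (abs_le.1 a1).1
    have a2' := (abs_le.1 a2).1
    have b1 : δ * (-(m * ‖F‖)) ≤ δ * inner ℝ (V v F E s) F := mul_le_mul_of_nonneg_left a1' hδ0
    have b2 : δ * (-(m * ‖F‖)) ≤ δ * inner ℝ (V v F E t) F := mul_le_mul_of_nonneg_left a2' hδ0
    have b3 : (δ / 2) ^ 2 * ‖E s F‖ ^ 2 ≤ (δ / 2) ^ 2 * ‖F‖ ^ 2 :=
      mul_le_mul_of_nonneg_left a3 (by positivity)
    have b4 : (δ / 2) ^ 2 * ‖F‖ ^ 2 ≤ δ * b * ‖F‖ ^ 2 := by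
      apply mul_le_mul_of_nonneg_right _ (by positivity)
      nlinarith
    have b5 : 0 ≤ (δ / 2) ^ 2 * ‖E t F‖ ^ 2 := by positivity
    rw [hC]
    nlinarith
  -- potential
  have p1 : inner ℝ (X t - X s) F = inner ℝ (X t - X s - δ • E t r) F + δ * inner ℝ (V v F E t) F
      + δ ^ 2 / 2 * ‖E t F‖ ^ 2 := by
    have : inner ℝ (E t F) F = ‖E t F‖ ^ 2 := by
      rw [← real_inner_self_eq_norm_sq, h.sym t ht (F) (E t F), h.c1 t t ht le_rfl, real_inner_comm]
    rw [inner_sub_left (X t - X s), inner_smul_left, hVt, inner_add_left, inner_smul_left, this]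
    simp only [conj_trivial]
    ring
  have p2 : inner ℝ (X t - X s - δ • E t r) F ≤ δ * (‖E s r - E t r‖ * ‖F‖) := by
    refine (real_inner_le_norm _ _).trans ?_
    rw [← mul_assoc]
    exact mul_le_mul_of_nonneg_right m2 (norm_nonneg _)
  have p3 : ‖E s r - E t r‖ * ‖F‖ ≤ ε + ‖E s r - E t r‖ ^ 2 * ‖F‖ ^ 2 / (4 * ε) := by
    have : 0 ≤ (‖E s r - E t r‖ * ‖F‖ - 2 * ε) ^ 2 / (4 * ε) := by positivity
    have e : (‖E s r - E t r‖ * ‖F‖ - 2 * ε) ^ 2 / (4 * ε) =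
      ε + ‖E s r - E t r‖ ^ 2 * ‖F‖ ^ 2 / (4 * ε) - ‖E s r - E t r‖ * ‖F‖ := by
      field_simp; ring
    linarith
  have p4 : ‖E t F‖ ^ 2 ≤ ‖F‖ ^ 2 := by gcongr; exact h.normE ht F
  have p5 : ‖E s r - E t r‖ ^ 2 * ‖F‖ ^ 2 / (4 * ε) ≤
      (2 * ((1/2) * ‖V v F E s‖ ^ 2 - (1/2) * ‖V v F E t‖ ^ 2) + C * δ) * ‖F‖ ^ 2 / (4 * ε) := by
    gcongr
  have p6 : δ * (‖E s r - E t r‖ * ‖F‖) ≤ δ * (ε +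
      (2 * ((1/2) * ‖V v F E s‖ ^ 2 - (1/2) * ‖V v F E t‖ ^ 2) + C * δ) * ‖F‖ ^ 2 / (4 * ε)) :=
    mul_le_mul_of_nonneg_left (by linarith) hδ0
  have p7 : δ ^ 2 / 2 * ‖E t F‖ ^ 2 ≤ δ ^ 2 / 2 * ‖F‖ ^ 2 :=
    mul_le_mul_of_nonneg_left p4 (by positivity)
  have p8 : δ * (ε +
      (2 * ((1/2) * ‖V v F E s‖ ^ 2 - (1/2) * ‖V v F E t‖ ^ 2) + C * δ) * ‖F‖ ^ 2 / (4 * ε)) +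
      δ ^ 2 / 2 * ‖F‖ ^ 2 = ε * δ + ‖F‖ ^ 2 / (2 * ε) * δ *
      ((1/2) * ‖V v F E s‖ ^ 2 - (1/2) * ‖V v F E t‖ ^ 2) +
      (‖F‖ ^ 2 * C / (4 * ε) + ‖F‖ ^ 2 / 2) * δ ^ 2 := by
    field_simp; ring
  have p9 : inner ℝ (X t - X s) F = inner ℝ (X t) F - inner ℝ (X s) F := inner_sub_left _ _ _
  have p10 : 0 ≤ ‖δ‖ ^ 2 * ‖E t F‖ ^ 2 := by positivity
  linarith

lemma lip (h : EPFlow Y X e v F E) : ∃ m : ℝ, 0 ≤ m ∧ ∀ s t, 0 ≤ s → s ≤ t →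
    ‖X t - X s‖ ≤ m * (t - s) := by
  set m := √(‖V v F E 0‖ ^ 2 + 2 * inner ℝ (X 0) F) with hm
  have hV : ∀ t, 0 ≤ t → ‖V v F E t‖ ≤ m := by
    intro t ht
    apply Real.le_sqrt_of_sq_le
    have := h.energy le_rfl ht
    have := h.pos t ht
    linarith
  refine ⟨m, Real.sqrt_nonneg _, fun a b ha hab => ?_⟩
  have := ep_partition (h := fun t => ‖X t - X a‖ - m * (t - a)) (g := fun _ => 0) hab ?_
  · simp only [sub_self, norm_zero, mul_zero] at this
    linarith
  intro ε hε
  refine ⟨0, ‖F‖, fun s t has hst htb => ?_⟩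
  have hs := ha.trans has
  have m1 := (h.main hs hst).1
  have hδ0 : 0 ≤ t - s := by linarith
  rw [h.R_eq s t, map_smul, norm_smul, Real.norm_of_nonneg hδ0] at m1
  have hVs : E s (v - ((t + s) / 2) • F) = V v F E s - ((t - s) / 2) • E s F := by
    rw [V, ← map_smul, ← map_sub]; congr 1; module
  have n1 : ‖E s (v - ((t + s) / 2) • F)‖ ≤ m + (t - s) * ‖F‖ := by
    rw [hVs]
    refine (norm_sub_le _ _).trans (add_le_add (hV s hs) ?_)
    rw [norm_smul, Real.norm_of_nonneg (by linarith)]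
    have := h.normE hs F
    nlinarith [norm_nonneg F]
  have n2 := mul_le_mul_of_nonneg_left n1 hδ0
  have n3 : ‖X t - X a‖ ≤ ‖X t - X s‖ + ‖X s - X a‖ := norm_sub_le_norm_sub_add_norm_sub _ _ _
  have n4 : 0 ≤ ε * (t - s) := by positivity
  nlinarith

lemma deriv_ae (h : EPFlow Y X e v F E) : ∃ N : Set ℝ, N.Countable ∧ ∀ t, 0 ≤ t → t ∉ N →
    Tendsto (fun τ : ℝ => ‖τ⁻¹ • (X (t + τ) - X t) - V v F E t‖) (𝓝[≠] 0) (𝓝 0) := by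
  have hanti : ∀ a : H, AntitoneOn (fun t => ‖E t a‖ ^ 2) (Ici 0) := by
    intro a s hs t _ hst
    have h1 := h.diffE hs hst a
    have : 0 ≤ ‖E s a - E t a‖ ^ 2 := by positivity
    simp only
    linarith
  refine ⟨{x ∈ Ici 0 | ¬ ContinuousWithinAt (fun t => ‖E t v‖ ^ 2) (Ici 0) x} ∪
    {x ∈ Ici 0 | ¬ ContinuousWithinAt (fun t => ‖E t F‖ ^ 2) (Ici 0) x} ∪ {0},
    (((hanti v).countable_not_continuousWithinAt).union
    ((hanti F).countable_not_continuousWithinAt)).union (countable_singleton 0), ?_⟩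
  intro t ht hN
  simp only [mem_union, mem_ofPred_eq, mem_Ici, mem_singleton_iff, not_or, not_and, not_not] at hN
  obtain ⟨⟨hv, hF⟩, h0⟩ := hN
  have ht0 : 0 < t := lt_of_le_of_ne ht (Ne.symm h0)
  have hcont : ∀ a : H, ContinuousWithinAt (fun t => ‖E t a‖ ^ 2) (Ici 0) t →
      ContinuousAt (fun t => E t a) t := by
    intro a ha
    have ha' : ContinuousAt (fun t => ‖E t a‖ ^ 2) t := ha.continuousAt (Ici_mem_nhds ht0)
    rw [ContinuousAt, tendsto_iff_norm_sub_tendsto_zero]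
    have h2 : Tendsto (fun x => √|‖E x a‖ ^ 2 - ‖E t a‖ ^ 2|) (𝓝 t) (𝓝 0) := by
      have : Tendsto (fun x => √|‖E x a‖ ^ 2 - ‖E t a‖ ^ 2|) (𝓝 t)
          (𝓝 (√|‖E t a‖ ^ 2 - ‖E t a‖ ^ 2|)) :=
        (Real.continuous_sqrt.tendsto _).comp ((ha'.tendsto.sub_const _).abs)
      simpa using this
    refine h2.congr' ?_
    filter_upwards [Ioi_mem_nhds ht0] with x hx
    have hx : 0 < x := hx
    rw [eq_comm, ← Real.sqrt_sq (norm_nonneg _)]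
    congr 1
    rcases le_total x t with hxt | hxt
    · have := h.diffE hx.le hxt a
      rw [← this, abs_of_nonneg (by positivity)]
    · have := h.diffE ht hxt a
      rw [abs_sub_comm, ← this, abs_of_nonneg (by positivity), norm_sub_rev]
  have cv := hcont v (hv ht)
  have cF := hcont F (hF ht)
  -- general limit
  have hlim : ∀ φ : ℝ → ℝ, Tendsto φ (𝓝[≠] 0) (𝓝 t) →
      Tendsto (fun τ => E (φ τ) (v - (t + τ / 2) • F)) (𝓝[≠] 0) (𝓝 (V v F E t)) := by
    intro φ hφ
    have h1 : Tendsto (fun τ : ℝ => t + τ / 2) (𝓝[≠] 0) (𝓝 t) := by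
      have : Tendsto (fun τ : ℝ => t + τ / 2) (𝓝 0) (𝓝 (t + 0 / 2)) :=
        (by fun_prop : Continuous (fun τ : ℝ => t + τ / 2)).tendsto 0
      simp only [zero_div, add_zero] at this
      exact this.mono_left nhdsWithin_le_nhds
    have := (cv.tendsto.comp hφ).sub (h1.smul (cF.tendsto.comp hφ))
    simpa [V, Function.comp_def] using this
  have hmin : Tendsto (fun τ : ℝ => min t (t + τ)) (𝓝[≠] 0) (𝓝 t) := by
    have : Tendsto (fun τ : ℝ => min t (t + τ)) (𝓝 0) (𝓝 (min t (t + 0))) :=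
      (by fun_prop : Continuous (fun τ : ℝ => min t (t + τ))).tendsto 0
    simp only [add_zero, min_self] at this
    exact this.mono_left nhdsWithin_le_nhds
  have hmax : Tendsto (fun τ : ℝ => max t (t + τ)) (𝓝[≠] 0) (𝓝 t) := by
    have : Tendsto (fun τ : ℝ => max t (t + τ)) (𝓝 0) (𝓝 (max t (t + 0))) :=
      (by fun_prop : Continuous (fun τ : ℝ => max t (t + τ))).tendsto 0
    simp only [add_zero, max_self] at this
    exact this.mono_left nhdsWithin_le_nhds
  have l1 := hlim _ hmin
  have l2 := hlim _ hmax
  have b1 : Tendsto (fun τ => ‖E (min t (t + τ)) (v - (t + τ / 2) • F) -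
      E (max t (t + τ)) (v - (t + τ / 2) • F)‖ +
      ‖E (max t (t + τ)) (v - (t + τ / 2) • F) - V v F E t‖) (𝓝[≠] 0) (𝓝 0) := by
    have := (l1.sub l2).norm.add (l2.sub_const (V v F E t)).norm
    simpa using this
  refine squeeze_zero' (Eventually.of_forall fun _ => norm_nonneg _) ?_ b1
  have hev : ∀ᶠ τ : ℝ in 𝓝[≠] 0, 0 < t + τ := by
    have : Tendsto (fun τ : ℝ => t + τ) (𝓝 0) (𝓝 (t + 0)) :=
      (by fun_prop : Continuous (fun τ : ℝ => t + τ)).tendsto 0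
    rw [add_zero] at this
    exact (this.mono_left nhdsWithin_le_nhds).eventually (Ioi_mem_nhds ht0)
  filter_upwards [hev, self_mem_nhdsWithin] with τ hτ hτ0
  have hτ0 : τ ≠ 0 := hτ0
  refine (norm_sub_le_norm_sub_add_norm_sub _ (E (max t (t + τ)) (v - (t + τ / 2) • F)) _).trans ?_
  refine add_le_add ?_ le_rfl
  rcases lt_or_gt_of_ne hτ0 with hneg | hpos
  · have m2 := (h.main hτ.le (by linarith : t + τ ≤ t)).2
    rw [min_eq_right (by linarith), max_eq_left (by linarith)]
    rw [h.R_eq] at m2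
    have e1 : t - (t + τ) = -τ := by ring
    have e2 : (t + (t + τ)) / 2 = t + τ / 2 := by ring
    rw [e1, e2, map_smul, map_smul, ← smul_sub, norm_smul, Real.norm_of_nonneg (by linarith)] at m2
    have e3 : τ⁻¹ • (X (t + τ) - X t) - E t (v - (t + τ / 2) • F) =
        (-τ)⁻¹ • (X t - X (t + τ) - (-τ) • E t (v - (t + τ / 2) • F)) := by
      rw [smul_sub (-τ)⁻¹, smul_smul, inv_mul_cancel₀ (by linarith : -τ ≠ 0), one_smul, inv_neg,
        neg_smul, ← smul_neg, neg_sub]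
    rw [e3, norm_smul, Real.norm_of_nonneg (inv_nonneg.2 (by linarith : 0 ≤ -τ)),
      inv_mul_le_iff₀ (by linarith)]
    exact m2
  · have m2 := (h.main ht (by linarith : t ≤ t + τ)).2
    rw [min_eq_left (by linarith), max_eq_right (by linarith)]
    rw [h.R_eq] at m2
    have e1 : (t + τ) - t = τ := by ring
    have e2 : (t + τ + t) / 2 = t + τ / 2 := by ring
    rw [e1, e2, map_smul, map_smul, ← smul_sub, norm_smul, Real.norm_of_nonneg (by linarith)] at m2
    have e3 : τ⁻¹ • (X (t + τ) - X t) - E (t + τ) (v - (t + τ / 2) • F) =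
        τ⁻¹ • (X (t + τ) - X t - τ • E (t + τ) (v - (t + τ / 2) • F)) := by
      rw [smul_sub τ⁻¹ (X (t + τ) - X t) (τ • _), smul_smul, inv_mul_cancel₀ hτ0, one_smul]
    rw [e3, norm_smul, Real.norm_of_nonneg (inv_nonneg.2 hpos.le), inv_mul_le_iff₀ hpos]
    exact m2

end EPFlow


lemma ep_msupp_closure {ρ : Measure ℝ} {S : Set ℝ} (hS : S ∈ ae ρ) : msupp ρ ⊆ closure S := by
  intro y hy
  rw [Metric.mem_closure_iff]
  intro ε hε
  have h1 := hy ε hε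
  by_contra! hc
  have h2 : Ioo (y - ε) (y + ε) ⊆ Sᶜ := by
    intro x hx hxS
    have := hc x hxS
    rw [Real.dist_eq, le_abs] at this
    rcases this with h | h <;> linarith [hx.1, hx.2]
  have h3 : ρ Sᶜ = 0 := hS
  exact h1.ne' (measure_mono_null h2 h3)

lemma ep_msupp_ae (ρ : Measure ℝ) : msupp ρ ∈ ae ρ := by
  have h : ρ.support ∈ ae ρ := Measure.support_mem_ae
  filter_upwards [h] with x hx
  intro δ hδ
  rw [Measure.mem_support_iff_forall] at hx
  exact hx _ (Ioo_mem_nhds (by linarith) (by linarith))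

lemma ep_ext {ρ : Measure ℝ} {S : Set ℝ} (hS : S ∈ ae ρ) {f : ℝ × ℝ → ℝ} (hf : Continuous f)
    (h : ∀ y ∈ S, ∀ z ∈ S, z ≤ y → 0 ≤ f (y, z)) (hd : ∀ y, 0 ≤ f (y, y)) :
    ∀ y ∈ msupp ρ, ∀ z ∈ msupp ρ, z ≤ y → 0 ≤ f (y, z) := by
  intro y hy z hz hzy
  rcases hzy.eq_or_lt with rfl | hlt
  · exact hd _
  obtain ⟨yn, hyn, hy'⟩ := mem_closure_iff_seq_limit.1 (ep_msupp_closure hS hy)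
  obtain ⟨zn, hzn, hz'⟩ := mem_closure_iff_seq_limit.1 (ep_msupp_closure hS hz)
  have h1 : ∀ᶠ n in atTop, zn n < yn n := hz'.eventually_lt hy' hlt
  have h2 : Tendsto (fun n => f (yn n, zn n)) atTop (𝓝 (f (y, z))) :=
    (hf.tendsto _).comp (hy'.prodMk_nhds hz')
  exact ge_of_tendsto h2 (h1.mono fun n hn => h _ (hyn n) _ (hzn n) hn.le)

lemma EPIso.congrX {ρ : Measure ℝ} {f X X' : ℝ → ℝ} (h : EPIso ρ f X) (hm : Measurable X')
    (he : X =ᵐ[ρ] X') : EPIso ρ f X' := by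
  refine ⟨h.mf, h.mX.ae_eq he, hm, h.mon.congr he, ?_, ?_⟩
  · intro k hk hkm
    rw [← integral_congr_ae (f := fun x => (f x - X x) * k x)]
    · exact h.polar k hk hkm
    · filter_upwards [he] with x hx
      rw [hx]
  · rw [← h.compl]
    apply integral_congr_ae
    filter_upwards [he] with x hx
    rw [hx]

lemma EPIso.scale {ρ : Measure ℝ} {f X : ℝ → ℝ} (h : EPIso ρ f X) {c : ℝ} (hc : 0 ≤ c) :
    EPIso ρ (fun x => c * f x) (fun x => c * X x) := by
  refine ⟨h.mf.const_mul c, h.mX.const_mul c, h.meas.const_mul c, h.mon.smul hc, ?_, ?_⟩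
  · intro k hk hkm
    have : ∀ x, (c * f x - c * X x) * k x = c * ((f x - X x) * k x) := fun x => by ring
    simp only [this]
    rw [integral_const_mul]
    exact mul_nonpos_of_nonneg_of_nonpos hc (h.polar k hk hkm)
  · have : ∀ x, (c * f x - c * X x) * (c * X x) = c * c * ((f x - X x) * X x) := fun x => by ring
    simp only [this]
    rw [integral_const_mul, h.compl, mul_zero]

lemma EPIso.of_mon {ρ : Measure ℝ} {f : ℝ → ℝ} (hf : MemLp f 2 ρ) (hm : Measurable f)
    (hmon : EPMon ρ f) : EPIso ρ f f :=
  ⟨hf, hf, hm, hmon, fun k _ _ => by simp, by simp⟩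

/-- basic data -/
structure EPData (ρ : Measure ℝ) (v T F : ℝ → ℝ) : Prop where
  mid : MemLp (fun x : ℝ => x) 2 ρ
  mv : MemLp v 2 ρ
  mF : MemLp F 2 ρ
  Fmon : Monotone F
  Tmon : Monotone T
  Tcont : Continuous T
  Tv : Monotone (fun x => T x - v x)

/-- free transport -/
def epY (v F : ℝ → ℝ) (t : ℝ) (x : ℝ) : ℝ := x + t * v x - t ^ 2 / 2 * F x

/-- the family of trajectories -/
structure EPFam (ρ : Measure ℝ) (v T F : ℝ → ℝ) (X : ℝ → ℝ → ℝ) : Prop where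
  cont : ∀ t, Continuous (X t)
  zero : X 0 = fun x => x
  iso : ∀ t, 0 ≤ t → EPIso ρ (epY v F t) (X t)
  two : ∀ t, 0 ≤ t → ∀ y ∈ msupp ρ, ∀ z ∈ msupp ρ, z ≤ y → 0 ≤ X t y - X t z ∧
    X t y - X t z ≤ (y - z) + t * (T y - T z)
  three : ∀ s t, 0 < s → s ≤ t → ∀ y ∈ msupp ρ, ∀ z ∈ msupp ρ, z ≤ y →
    X t y - X t z ≤ t / s * (X s y - X s z)

lemma EPData.memY {ρ : Measure ℝ} {v T F : ℝ → ℝ} (h : EPData ρ v T F) (t : ℝ) :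
    MemLp (epY v F t) 2 ρ :=
  (h.mid.add (h.mv.const_mul t)).sub (h.mF.const_mul (t ^ 2 / 2))

lemma EPData.one {ρ : Measure ℝ} [IsProbabilityMeasure ρ] {v T F : ℝ → ℝ} (h : EPData ρ v T F)
    {t : ℝ} (ht : 0 ≤ t) :
    ∃ X, Continuous X ∧ EPIso ρ (epY v F t) X := by
  obtain ⟨X, hX⟩ := ep_exists_iso ρ _ (h.memY t)
  set N : ℝ → ℝ := fun x => x + t * T x with hN
  have hNc : Continuous N := continuous_id.add (continuous_const.mul h.Tcont)
  have hNs : StrictMono N := strictMono_id.add_monotone (h.Tmon.const_mul ht)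
  obtain ⟨S, hS, hgap⟩ := ep_gap (ζ := fun _ => 0) hX hNc.measurable (integrable_zero _ _ _)
    (by simp) (by simp) (EPMon.of_monotone hNs.monotone) (by
      have h1 : Monotone (fun x => t * (T x - v x) + t ^ 2 / 2 * F x) :=
        (h.Tv.const_mul ht).add (h.Fmon.const_mul (by positivity))
      convert EPMon.of_monotone (ρ := ρ) h1 using 2 with x
      simp only [hN, epY]; ring)
  obtain ⟨inv, hinv⟩ := hNs.injective.hasLeftInverse
  have hlip : LipschitzOnWith 1 (X ∘ inv) (N '' S) := by
    rw [lipschitzOnWith_iff_dist_le_mul]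
    rintro _ ⟨y, hy, rfl⟩ _ ⟨z, hz, rfl⟩
    simp only [Function.comp, hinv y, hinv z, Real.dist_eq, NNReal.coe_one, one_mul]
    rcases le_total z y with hzy | hzy
    · have := hgap y hy z hz hzy
      rw [abs_of_nonneg this.1, abs_of_nonneg (this.1.trans this.2)]
      exact this.2
    · have := hgap z hz y hy hzy
      rw [abs_sub_comm, abs_sub_comm (N y), abs_of_nonneg this.1, abs_of_nonneg (this.1.trans this.2)]
      exact this.2
  obtain ⟨g, hg, hge⟩ := hlip.extend_real
  refine ⟨g ∘ N, hg.continuous.comp hNc, hX.congrX (hg.continuous.comp hNc).measurable ?_⟩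
  filter_upwards [hS] with x hx
  have := hge (mem_image_of_mem N hx)
  simp only [Function.comp, hinv x] at this
  exact this

lemma EPData.fam {ρ : Measure ℝ} [IsProbabilityMeasure ρ] {v T F : ℝ → ℝ} (h : EPData ρ v T F) :
    ∃ X, EPFam ρ v T F X := by
  have h0 : ∀ t : ℝ, ∃ X : ℝ → ℝ, Continuous X ∧ (0 ≤ t → Continuous X ∧ EPIso ρ (epY v F t) X ∧
      (t = 0 → X = fun x => x)) := by
    intro t
    rcases lt_trichotomy t 0 with ht | ht | ht
    · exact ⟨fun x => x, continuous_id, fun h => absurd h (not_le.2 ht)⟩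
    · refine ⟨fun x => x, continuous_id, fun _ => ⟨continuous_id, ?_, fun _ => rfl⟩⟩
      have : epY v F t = fun x => x := by
        funext x; simp [epY, ht]
      rw [this]
      exact EPIso.of_mon h.mid measurable_id (EPMon.of_monotone monotone_id)
    · obtain ⟨X, hc, hX⟩ := h.one ht.le
      exact ⟨X, hc, fun _ => ⟨hc, hX, fun h => absurd h ht.ne'⟩⟩
  choose X hXc hX using h0
  refine ⟨X, ?_, ?_, ?_, ?_, ?_⟩
  · exact hXc
  · exact (hX 0 le_rfl).2.2 rfl
  · exact fun t ht => (hX t ht).2.1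
  · intro t ht
    have hXt := (hX t ht).2.1
    have hc := (hX t ht).1
    set N : ℝ → ℝ := fun x => x + t * T x with hN
    have hNc : Continuous N := continuous_id.add (continuous_const.mul h.Tcont)
    have hNs : StrictMono N := strictMono_id.add_monotone (h.Tmon.const_mul ht)
    obtain ⟨S, hS, hgap⟩ := ep_gap (ζ := fun _ => 0) hXt hNc.measurable (integrable_zero _ _ _)
      (by simp) (by simp) (EPMon.of_monotone hNs.monotone) (by
        have h1 : Monotone (fun x => t * (T x - v x) + t ^ 2 / 2 * F x) :=
          (h.Tv.const_mul ht).add (h.Fmon.const_mul (by positivity))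
        convert EPMon.of_monotone (ρ := ρ) h1 using 2 with x
        simp only [hN, epY]; ring)
    have e1 := ep_ext hS (f := fun p => X t p.1 - X t p.2) (by fun_prop)
      (fun y hy z hz hzy => (hgap y hy z hz hzy).1) (by simp)
    have e2 := ep_ext hS (f := fun p => (N p.1 - N p.2) - (X t p.1 - X t p.2)) (by fun_prop)
      (fun y hy z hz hzy => sub_nonneg.2 (hgap y hy z hz hzy).2) (by simp)
    intro y hy z hz hzy
    refine ⟨e1 y hy z hz hzy, ?_⟩
    have := e2 y hy z hz hzy
    simp only [hN] at this
    linarith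
  · intro s t hs hst
    have ht : 0 < t := hs.trans_le hst
    obtain ⟨hct, hXt, -⟩ := hX t ht.le
    obtain ⟨hcs, hXs, -⟩ := hX s hs.le
    have hsc := hXs.scale (c := t / s) (by positivity)
    have hr : 1 ≤ t / s := (one_le_div hs).2 hst
    have hw : EPMon ρ (fun x => t / s * epY v F s x - epY v F t x) := by
      have h1 : Monotone (fun x : ℝ => (t / s - 1) * x + (t ^ 2 - t * s) / 2 * F x) :=
        (monotone_id.const_mul (by linarith)).add (h.Fmon.const_mul (by nlinarith))
      convert EPMon.of_monotone (ρ := ρ) h1 using 2 with x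
      simp only [epY]; field_simp; ring
    obtain ⟨S, hS, hgap⟩ := ep_gap (Z := fun x => t / s * X s x)
      (ζ := fun x => t / s * epY v F s x - t / s * X s x) hXt hsc.meas hsc.intξ
      (fun B hB => hsc.borel B hB) (fun B hB => ep_stick hXt hsc hw B hB) hsc.mon (by
        convert hw using 2 with x
        ring)
    have e2 := ep_ext hS (f := fun p => (t / s * X s p.1 - t / s * X s p.2) -
      (X t p.1 - X t p.2)) (by fun_prop)
      (fun y hy z hz hzy => sub_nonneg.2 (hgap y hy z hz hzy).2) (by simp)
    intro y hy z hz hzy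
    have := e2 y hy z hz hzy
    simp only at this
    linarith


lemma ep_sign_mono : Monotone Real.sign := by
  intro x y hxy
  unfold Real.sign
  split_ifs <;> linarith

lemma ep_sign_meas : Measurable Real.sign := ep_sign_mono.measurable

lemma ep_sign_abs (x : ℝ) : |Real.sign x| ≤ 1 := by
  rcases Real.sign_apply_eq x with h | h | h <;> rw [h] <;> norm_num

lemma ep_sign_int {ρ : Measure ℝ} [IsProbabilityMeasure ρ] (y : ℝ) {X : ℝ → ℝ} (hX : Measurable X) :
    Integrable (fun z => Real.sign (y - X z)) ρ :=
  Integrable.of_bound (C := 1)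
    (ep_sign_meas.comp (measurable_const.sub hX)).aestronglyMeasurable
    (ae_of_all _ fun z => by rw [Real.norm_eq_abs]; exact ep_sign_abs _)

/-- the force -/
def epF (ρ : Measure ℝ) (y : ℝ) : ℝ := ∫ z, Real.sign (y - z) ∂ρ

lemma epF_mono {ρ : Measure ℝ} [IsProbabilityMeasure ρ] : Monotone (epF ρ) := by
  intro x y hxy
  refine integral_mono (ep_sign_int x measurable_id) (ep_sign_int y measurable_id) fun z => ?_
  exact ep_sign_mono (by linarith)

lemma epF_abs {ρ : Measure ℝ} [IsProbabilityMeasure ρ] (y : ℝ) : |epF ρ y| ≤ 1 := by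
  have := norm_integral_le_of_norm_le_const (μ := ρ) (f := fun z => Real.sign (y - z)) (C := 1)
    (ae_of_all _ fun z => by rw [Real.norm_eq_abs]; exact ep_sign_abs _)
  simpa [epF] using this

lemma epF_mem {ρ : Measure ℝ} [IsProbabilityMeasure ρ] : MemLp (epF ρ) 2 ρ :=
  MemLp.of_bound epF_mono.measurable.aestronglyMeasurable 1
    (ae_of_all _ fun z => by rw [Real.norm_eq_abs]; exact epF_abs _)

lemma ep_energy_id {ρ : Measure ℝ} [IsProbabilityMeasure ρ] {X : ℝ → ℝ} (hX : MemLp X 2 ρ)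
    (hm : EPMon ρ X) :
    ∫ y, ∫ z, (1/2) * |X y - X z| ∂ρ ∂ρ = ∫ y, X y * epF ρ y ∂ρ := by
  obtain ⟨S, hS, hmS⟩ := hm
  have hXi : Integrable X ρ := hX.integrable (by norm_num)
  have hsm : Measurable (fun p : ℝ × ℝ => Real.sign (p.1 - p.2)) :=
    ep_sign_meas.comp (measurable_fst.sub measurable_snd)
  have hI : Integrable (fun p : ℝ × ℝ => X p.2 * Real.sign (p.1 - p.2)) (ρ.prod ρ) :=
    (hXi.comp_snd ρ).mul_bdd (c := 1) hsm.aestronglyMeasurable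
      (ae_of_all _ fun z => by rw [Real.norm_eq_abs]; exact ep_sign_abs _)
  have hneg : ∀ z, ∫ y, Real.sign (y - z) ∂ρ = - epF ρ z := by
    intro z
    rw [epF, ← integral_neg]
    congr 1; funext y
    rw [← Real.sign_neg, neg_sub]
  have h2 : ∫ y, ∫ z, X z * Real.sign (y - z) ∂ρ ∂ρ = - ∫ y, X y * epF ρ y ∂ρ := by
    rw [integral_integral_swap (f := fun y z => X z * Real.sign (y - z)) hI, ← integral_neg]
    congr 1; funext z
    rw [integral_const_mul, hneg, mul_neg]
  have hXF : Integrable (fun y => X y * epF ρ y) ρ :=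
    hXi.mul_bdd (c := 1) epF_mono.measurable.aestronglyMeasurable
      (ae_of_all _ fun z => by rw [Real.norm_eq_abs]; exact epF_abs _)
  have h1 : ∀ᵐ y ∂ρ, ∫ z, (1/2) * |X y - X z| ∂ρ =
      (1/2) * (X y * epF ρ y - ∫ z, X z * Real.sign (y - z) ∂ρ) := by
    filter_upwards [hS] with y hy
    have i1 : Integrable (fun z => X y * Real.sign (y - z)) ρ :=
      (ep_sign_int y measurable_id).const_mul _
    have i2 : Integrable (fun z => X z * Real.sign (y - z)) ρ :=
      hXi.mul_bdd (c := 1)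
        (ep_sign_meas.comp (measurable_const.sub measurable_id)).aestronglyMeasurable
        (ae_of_all _ fun z => by rw [Real.norm_eq_abs]; exact ep_sign_abs _)
    rw [epF, ← integral_const_mul, ← integral_sub i1 i2, ← integral_const_mul]
    apply integral_congr_ae
    filter_upwards [hS] with z hz
    rcases lt_trichotomy y z with h | h | h
    · rw [Real.sign_of_neg (by linarith), abs_of_nonpos (by linarith [hmS hy hz h.le])]
      simp; ring
    · rw [h]; simp
    · rw [Real.sign_of_pos (by linarith), abs_of_nonneg (by linarith [hmS hz hy h.le])]
      simp
  rw [integral_congr_ae h1, integral_const_mul, integral_sub hXF hI.integral_prod_left, h2]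
  ring

lemma ep_energy_nonneg {ρ : Measure ℝ} [IsProbabilityMeasure ρ] {X : ℝ → ℝ} (hX : MemLp X 2 ρ)
    (hm : EPMon ρ X) : 0 ≤ ∫ y, X y * epF ρ y ∂ρ := by
  rw [← ep_energy_id hX hm]
  exact integral_nonneg fun y => integral_nonneg fun z => by positivity

lemma ep_ortho {ρ : Measure ℝ} [IsProbabilityMeasure ρ] {X ξ a : ℝ → ℝ} (hX : Measurable X)
    (hξ : MemLp ξ 2 ρ) (hb : ∀ B, MeasurableSet B → ∫ x in X ⁻¹' B, ξ x ∂ρ = 0)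
    (ha : MemLp a 2 ρ)
    (ham : AEStronglyMeasurable[MeasurableSpace.comap X inferInstance] a ρ) :
    ∫ x, ξ x * a x ∂ρ = 0 := by
  have hm : MeasurableSpace.comap X inferInstance ≤ (inferInstance : MeasurableSpace ℝ) :=
    hX.comap_le
  have hξi : Integrable ξ ρ := hξ.integrable (by norm_num)
  have h0 : (fun _ => (0:ℝ)) =ᵐ[ρ] ρ[ξ | MeasurableSpace.comap X inferInstance] := by
    refine ae_eq_condExp_of_forall_setIntegral_eq hm hξi ?_ ?_ ?_
    · intro s _ _; exact (integrable_zero _ _ _)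
    · rintro s ⟨B, hB, rfl⟩ _
      rw [hb B hB]; simp
    · exact stronglyMeasurable_const.aestronglyMeasurable
  have hint : Integrable (ξ * a) ρ := hξ.integrable_mul ha
  have h1 := condExp_mul_of_aestronglyMeasurable_right (m := MeasurableSpace.comap X inferInstance)
    ham hint hξi
  have h2 := integral_condExp hm (μ := ρ) (f := ξ * a)
  have h3 : ∫ x, ξ x * a x ∂ρ = ∫ x, (ξ * a) x ∂ρ := rfl
  rw [h3, ← h2, integral_congr_ae h1]
  rw [← integral_zero ℝ ℝ (μ := ρ)]
  apply integral_congr_ae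
  filter_upwards [h0] with x hx
  rw [Pi.mul_apply, ← hx, zero_mul]

/-- subspace of functions of X -/
def epM (ρ : Measure ℝ) (X : ℝ → ℝ) : Submodule ℝ (Lp ℝ 2 ρ) :=
  lpMeas ℝ ℝ (MeasurableSpace.comap X inferInstance) 2 ρ

lemma epM_iff {ρ : Measure ℝ} {X : ℝ → ℝ} {a : Lp ℝ 2 ρ} :
    a ∈ epM ρ X ↔ ∃ u : ℝ → ℝ, Measurable u ∧ a =ᵐ[ρ] u ∘ X := by
  rw [epM, mem_lpMeas_iff_aestronglyMeasurable]
  constructor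
  · rintro ⟨f, hf, hae⟩
    obtain ⟨u, hu, rfl⟩ := hf.exists_eq_measurable_comp
    exact ⟨u, hu.measurable, hae⟩
  · rintro ⟨u, hu, hae⟩
    refine ⟨u ∘ X, ?_, hae⟩
    exact (hu.comp (comap_measurable X)).stronglyMeasurable

lemma epM_proj {ρ : Measure ℝ} {X : ℝ → ℝ} (hX : Measurable X) :
    (epM ρ X).HasOrthogonalProjection := by
  have : Fact (MeasurableSpace.comap X inferInstance ≤ (inferInstance : MeasurableSpace ℝ)) :=
    ⟨hX.comap_le⟩
  unfold epM
  infer_instance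

lemma ep_inner {ρ : Measure ℝ} {f g : ℝ → ℝ} (hf : MemLp f 2 ρ) (hg : MemLp g 2 ρ) :
    inner ℝ (hf.toLp f) (hg.toLp g) = ∫ x, f x * g x ∂ρ := by
  rw [L2.inner_def]
  apply integral_congr_ae
  filter_upwards [hf.coeFn_toLp, hg.coeFn_toLp] with x h1 h2
  rw [h1, h2]
  simp [mul_comm]

lemma ep_inner' {ρ : Measure ℝ} (f g : Lp ℝ 2 ρ) :
    inner ℝ f g = ∫ x, f x * g x ∂ρ := by
  rw [L2.inner_def]
  congr 1; funext x
  simp [mul_comm]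

lemma ep_normsq {ρ : Measure ℝ} (f : Lp ℝ 2 ρ) : ‖f‖ ^ 2 = ∫ x, (f x) ^ 2 ∂ρ := by
  rw [← real_inner_self_eq_norm_sq, ep_inner']
  congr 1; funext x; ring

/-- factorization through earlier times -/
lemma EPFam.factor {ρ : Measure ℝ} {v T F : ℝ → ℝ} {X : ℝ → ℝ → ℝ} (h : EPFam ρ v T F X)
    {s t : ℝ} (hs : 0 ≤ s) (hst : s ≤ t) :
    ∃ φ : ℝ → ℝ, Continuous φ ∧ ∀ y ∈ msupp ρ, X t y = φ (X s y) := by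
  rcases hs.eq_or_lt with rfl | hs
  · exact ⟨X t, h.cont t, fun y _ => by rw [h.zero]⟩
  have ht : 0 < t := hs.trans_le hst
  have key : ∀ y ∈ msupp ρ, ∀ z ∈ msupp ρ, |X t y - X t z| ≤ t / s * |X s y - X s z| := by
    intro y hy z hz
    rcases le_total z y with hzy | hzy
    · have h1 := h.three s t hs hst y hy z hz hzy
      rwa [abs_of_nonneg (h.two t ht.le y hy z hz hzy).1,
        abs_of_nonneg (h.two s hs.le y hy z hz hzy).1]
    · have h1 := h.three s t hs hst z hz y hy hzy
      rwa [abs_sub_comm, abs_sub_comm (X s y), abs_of_nonneg (h.two t ht.le z hz y hy hzy).1,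
        abs_of_nonneg (h.two s hs.le z hz y hy hzy).1]
  let inv : ℝ → ℝ := Function.invFunOn (X s) (msupp ρ)
  have hi1 : ∀ y ∈ msupp ρ, inv (X s y) ∈ msupp ρ := fun y hy =>
    Function.invFunOn_mem ⟨y, hy, rfl⟩
  have hi2 : ∀ y ∈ msupp ρ, X s (inv (X s y)) = X s y := fun y hy =>
    Function.invFunOn_eq ⟨y, hy, rfl⟩
  have hlip : LipschitzOnWith (t / s).toNNReal (X t ∘ inv) (X s '' msupp ρ) := by
    rw [lipschitzOnWith_iff_dist_le_mul]
    rintro _ ⟨y, hy, rfl⟩ _ ⟨z, hz, rfl⟩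
    have := key _ (hi1 y hy) _ (hi1 z hz)
    rw [hi2 y hy, hi2 z hz] at this
    rw [Real.coe_toNNReal _ (by positivity), Real.dist_eq, Real.dist_eq]
    exact this
  obtain ⟨g, hg, hge⟩ := hlip.extend_real
  refine ⟨g, hg.continuous, fun y hy => ?_⟩
  rw [← hge (mem_image_of_mem _ hy)]
  have := key _ (hi1 y hy) _ hy
  rw [hi2 y hy, sub_self, abs_zero, mul_zero] at this
  have := abs_nonpos_iff.1 this
  simp only [Function.comp]
  linarith

lemma EPFam.anti {ρ : Measure ℝ} {v T F : ℝ → ℝ} {X : ℝ → ℝ → ℝ} (h : EPFam ρ v T F X)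
    {s t : ℝ} (hs : 0 ≤ s) (hst : s ≤ t) : epM ρ (X t) ≤ epM ρ (X s) := by
  intro a ha
  obtain ⟨u, hu, hae⟩ := epM_iff.1 ha
  obtain ⟨φ, hφ, hX⟩ := h.factor hs hst
  refine epM_iff.2 ⟨u ∘ φ, hu.comp hφ.measurable, ?_⟩
  filter_upwards [hae, ep_msupp_ae ρ] with y h1 h2
  rw [h1]
  simp only [Function.comp, hX y h2]


lemma ep_toLp_ext {ρ : Measure ℝ} {f : ℝ → ℝ} (hf : MemLp f 2 ρ) (a : Lp ℝ 2 ρ) (h : f =ᵐ[ρ] a) :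
    hf.toLp f = a := by
  apply Lp.ext
  exact hf.coeFn_toLp.trans h

lemma ep_flow {ρ : Measure ℝ} [IsProbabilityMeasure ρ] {v T : ℝ → ℝ} {X : ℝ → ℝ → ℝ}
    (hd : EPData ρ v T (epF ρ)) (h : EPFam ρ v T (epF ρ) X) :
    ∃ (V : ℝ → Lp ℝ 2 ρ) (L : ℝ) (N : Set ℝ), N.Countable ∧
      (∀ s t, 0 ≤ s → 0 ≤ t → ∫ y, (X t y - X s y) ^ 2 ∂ρ ≤ L * (t - s) ^ 2) ∧
      (∀ t, 0 ≤ t → t ≠ 0 → t ∉ N → HasL2DerivAt ρ X (V t) t) ∧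
      (∀ t, 0 ≤ t → ∃ u : ℝ → ℝ, Measurable u ∧ ∀ᵐ y ∂ρ, V t y = u (X t y)) ∧
      (∀ t, 0 ≤ t → ∀ g : ℝ → ℝ, Continuous g → (∃ M, ∀ x, |g x| ≤ M) →
        ∫ y, g (X t y) * V t y ∂ρ = ∫ y, g (X t y) * (v y - t * epF ρ y) ∂ρ) ∧
      (∀ s t, 0 ≤ s → s ≤ t → (∫ y, (1/2) * (V t y) ^ 2 ∂ρ) +
          (∫ y, ∫ z, (1/2) * |X t y - X t z| ∂ρ ∂ρ) ≤
        (∫ y, (1/2) * (V s y) ^ 2 ∂ρ) +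
          (∫ y, ∫ z, (1/2) * |X s y - X s z| ∂ρ ∂ρ)) := by
  classical
  let Xf : ℝ → ℝ → ℝ := fun t => X (max t 0)
  have hXf : ∀ t, 0 ≤ t → Xf t = X t := fun t ht => by simp [Xf, ht]
  have hmX : ∀ t, MemLp (Xf t) 2 ρ := fun t => (h.iso _ (le_max_right t 0)).mX
  let XL : ℝ → Lp ℝ 2 ρ := fun t => (hmX t).toLp (Xf t)
  let YL : ℝ → Lp ℝ 2 ρ := fun t => (hd.memY t).toLp _
  let e : Lp ℝ 2 ρ := hd.mid.toLp _
  let vL : Lp ℝ 2 ρ := hd.mv.toLp _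
  let FL : Lp ℝ 2 ρ := hd.mF.toLp _
  have hproj : ∀ t, (epM ρ (X t)).HasOrthogonalProjection := fun t =>
    epM_proj (h.cont t).measurable
  let E : ℝ → Lp ℝ 2 ρ →L[ℝ] Lp ℝ 2 ρ := fun t => (epM ρ (X t)).starProjection
  have hEmem : ∀ t a, E t a ∈ epM ρ (X t) := fun t a => Submodule.starProjection_apply_mem _ _
  have hEself : ∀ t a, a ∈ epM ρ (X t) → E t a = a := fun t a ha =>
    Submodule.starProjection_eq_self_iff.2 ha
  have hsym : ∀ t a b, inner ℝ (E t a) b = inner ℝ a (E t b) := fun t a b =>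
    Submodule.inner_starProjection_left_eq_right _ a b
  have hXmem : ∀ t, 0 ≤ t → XL t ∈ epM ρ (X t) := fun t ht =>
    epM_iff.2 ⟨id, measurable_id, (hmX t).coeFn_toLp.trans (by rw [hXf t ht]; rfl)⟩
  have hsub : ∀ t, YL t - XL t = ((hd.memY t).sub (hmX t)).toLp _ := fun t => by
    rw [MemLp.toLp_sub]
  have flow : EPFlow YL XL e vL FL E := by
    refine ⟨?_, fun t _ => hsym t, ?_, ?_, ?_, ?_, ?_, ?_⟩
    · intro t
      apply ep_toLp_ext
      filter_upwards [Lp.coeFn_sub (e + t • vL) ((t ^ 2 / 2) • FL), Lp.coeFn_add e (t • vL),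
        Lp.coeFn_smul t vL, Lp.coeFn_smul (t ^ 2 / 2) FL, hd.mid.coeFn_toLp, hd.mv.coeFn_toLp,
        hd.mF.coeFn_toLp] with x h1 h2 h3 h4 h5 h6 h7
      rw [h1, Pi.sub_apply, h2, Pi.add_apply, h3, h4, Pi.smul_apply, Pi.smul_apply]
      simp only [e, vL, FL, h5, h6, h7, epY, smul_eq_mul]
    · intro s t hs hst a
      have := Submodule.starProjection_comp_starProjection_of_le (h.anti hs hst)
      exact congrArg (fun f => f a) this
    · intro s t hs hst a
      exact hEself s _ (h.anti hs hst (hEmem t a))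
    · exact fun t ht => hEself t _ (hXmem t ht)
    · intro t ht
      refine Submodule.eq_starProjection_of_mem_of_inner_eq_zero (hXmem t ht) ?_
      intro w hw
      have hw' : w = (Lp.memLp w).toLp w := (Lp.toLp_coeFn w _).symm
      rw [hw', hsub, ep_inner]
      have := (h.iso t ht)
      rw [hXf t ht]
      refine ep_ortho this.meas this.memξ (fun B hB => this.borel B hB) (Lp.memLp w) ?_
      exact mem_lpMeas_iff_aestronglyMeasurable.1 hw
    · intro s t hs ht
      rw [hsub, ep_inner, hXf t ht]
      exact (h.iso t ht).polar _ (hmX s) (h.iso _ (le_max_right s 0)).mon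
    · intro t ht
      rw [ep_inner]
      exact ep_energy_nonneg (hmX t) (h.iso _ (le_max_right t 0)).mon
  obtain ⟨m, hm0, hm⟩ := flow.lip
  obtain ⟨N, hN, hder⟩ := flow.deriv_ae
  have hdiff : ∀ s t, 0 ≤ s → 0 ≤ t → ∫ y, (X t y - X s y) ^ 2 ∂ρ = ‖XL t - XL s‖ ^ 2 := by
    intro s t hs ht
    rw [ep_normsq]
    apply integral_congr_ae
    filter_upwards [Lp.coeFn_sub (XL t) (XL s), (hmX t).coeFn_toLp, (hmX s).coeFn_toLp]
      with x h1 h2 h3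
    rw [h1, Pi.sub_apply, h2, h3, hXf t ht, hXf s hs]
  refine ⟨EPFlow.V vL FL E, m ^ 2, N, hN, ?_, ?_, ?_, ?_, ?_⟩
  · intro s t hs ht
    rw [hdiff s t hs ht, ← mul_pow]
    rcases le_total s t with hst | hst
    · have := hm s t hs hst
      gcongr
    · have := hm t s ht hst
      rw [norm_sub_rev]
      calc _ ≤ (m * (s - t)) ^ 2 := by gcongr
        _ = _ := by ring
  · intro t ht ht0 htN
    have h1 := (hder t ht htN).pow 2
    rw [zero_pow two_ne_zero] at h1
    refine h1.congr' ?_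
    have hpos : 0 < t := lt_of_le_of_ne ht (Ne.symm ht0)
    have hev : ∀ᶠ τ : ℝ in 𝓝[≠] 0, 0 < t + τ := by
      apply eventually_nhdsWithin_of_eventually_nhds
      have : Tendsto (fun τ : ℝ => t + τ) (𝓝 0) (𝓝 (t + 0)) := by
        apply Continuous.tendsto; fun_prop
      rw [add_zero] at this
      exact this.eventually (lt_mem_nhds hpos)
    filter_upwards [hev] with τ hτ
    rw [ep_normsq]
    apply integral_congr_ae
    filter_upwards [Lp.coeFn_sub (τ⁻¹ • (XL (t + τ) - XL t)) (EPFlow.V vL FL E t),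
      Lp.coeFn_smul τ⁻¹ (XL (t + τ) - XL t), Lp.coeFn_sub (XL (t + τ)) (XL t),
      (hmX (t + τ)).coeFn_toLp, (hmX t).coeFn_toLp] with x h1 h2 h3 h4 h5
    rw [h1, Pi.sub_apply, h2, Pi.smul_apply, h3, Pi.sub_apply, h4, h5, hXf t ht, hXf _ hτ.le,
      smul_eq_mul]
    ring
  · intro t ht
    obtain ⟨u, hu, hae⟩ := epM_iff.1 (hEmem t (vL - t • FL))
    exact ⟨u, hu, hae⟩
  · rintro t ht g hg ⟨M, hM⟩
    have hgm : MemLp (fun y => g (X t y)) 2 ρ :=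
      MemLp.of_bound (hg.comp (h.cont t)).aestronglyMeasurable M
        (ae_of_all _ fun y => by rw [Real.norm_eq_abs]; exact hM _)
    have hgM : hgm.toLp _ ∈ epM ρ (X t) := epM_iff.2 ⟨g, hg.measurable, hgm.coeFn_toLp⟩
    have h1 : inner ℝ (hgm.toLp _) (EPFlow.V vL FL E t) = inner ℝ (hgm.toLp _) (vL - t • FL) := by
      rw [EPFlow.V, ← hsym, hEself t _ hgM]
    rw [ep_inner', ep_inner'] at h1
    calc _ = _ := ?_
      _ = _ := h1
      _ = _ := ?_
    · apply integral_congr_ae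
      filter_upwards [hgm.coeFn_toLp] with y h2
      rw [h2]
    · apply integral_congr_ae
      filter_upwards [hgm.coeFn_toLp, Lp.coeFn_sub vL (t • FL), Lp.coeFn_smul t FL,
        hd.mv.coeFn_toLp, hd.mF.coeFn_toLp] with y h2 h3 h4 h5 h6
      rw [h2, h3, Pi.sub_apply, h4, Pi.smul_apply, h5, h6, smul_eq_mul]
  · intro s t hs hst
    have ht := hs.trans hst
    have key : ∀ r, 0 ≤ r → (∫ y, (1/2) * (EPFlow.V vL FL E r y) ^ 2 ∂ρ) +
          (∫ y, ∫ z, (1/2) * |X r y - X r z| ∂ρ ∂ρ) =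
          (1/2) * ‖EPFlow.V vL FL E r‖ ^ 2 + inner ℝ (XL r) FL := by
      intro r hr
      rw [integral_const_mul, ep_normsq, ep_inner, hXf r hr,
        ep_energy_id (h.iso r hr).mX (h.iso r hr).mon]
    rw [key t ht, key s hs]
    exact flow.energy hs hst


lemma ep_msupp_meas (ρ : Measure ℝ) : MeasurableSet (msupp ρ) := by
  have : msupp ρ = ρ.support := by
    ext x
    rw [Measure.mem_support_iff_forall]
    constructor
    · intro hx U hU
      obtain ⟨ε, hε, hsub⟩ := Metric.mem_nhds_iff.1 hU
      refine (hx ε hε).trans_le (measure_mono ?_)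
      rwa [← Real.ball_eq_Ioo]
    · intro hx δ hδ
      exact hx _ (Ioo_mem_nhds (by linarith) (by linarith))
  rw [this]
  exact Measure.isClosed_support.measurableSet

lemma ep_time_cont {ρ : Measure ℝ} [IsProbabilityMeasure ρ] {v T F : ℝ → ℝ} {X : ℝ → ℝ → ℝ}
    (hT : Continuous T) (h : EPFam ρ v T F X) {L : ℝ}
    (hL : ∀ s t, 0 ≤ s → 0 ≤ t → ∫ y, (X t y - X s y) ^ 2 ∂ρ ≤ L * (t - s) ^ 2)
    {y : ℝ} (hy : y ∈ msupp ρ) : ContinuousOn (fun τ => X τ y) (Ici 0) := by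
  have hTm : ∀ τ, 0 ≤ τ → ∀ z ∈ msupp ρ, |X τ y - X τ z| ≤ |y - z| + τ * |T y - T z| := by
    intro τ hτ z hz
    rcases le_total z y with hzy | hzy
    · have := h.two τ hτ y hy z hz hzy
      rw [abs_of_nonneg this.1]
      refine this.2.trans ?_
      have a1 := le_abs_self (y - z)
      have a2 := mul_le_mul_of_nonneg_left (le_abs_self (T y - T z)) hτ
      linarith
    · have := h.two τ hτ z hz y hy hzy
      rw [abs_sub_comm, abs_of_nonneg this.1, abs_sub_comm y, abs_sub_comm (T y)]
      refine this.2.trans ?_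
      have a1 := le_abs_self (z - y)
      have a2 := mul_le_mul_of_nonneg_left (le_abs_self (T z - T y)) hτ
      linarith
  intro t₀ ht₀
  have ht₀ : 0 ≤ t₀ := ht₀
  rw [ContinuousWithinAt, Metric.tendsto_nhdsWithin_nhds]
  intro ε₀ hε₀
  set ε := ε₀ / 4 with hεd
  have hε : 0 < ε := by positivity
  -- choose δ
  have hc : Tendsto (fun z => |y - z| + (t₀ + 1) * |T y - T z|) (𝓝 y) (𝓝 0) := by
    have : Continuous (fun z => |y - z| + (t₀ + 1) * |T y - T z|) := by fun_prop
    have h2 := this.tendsto y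
    simpa using h2
  obtain ⟨δ, hδ, hδs⟩ := Metric.eventually_nhds_iff.1 (hc.eventually (gt_mem_nhds hε))
  set p := ρ.real (Ioo (y - δ) (y + δ)) with hp
  have hp0 : 0 < p := by
    rw [hp, measureReal_def]
    exact ENNReal.toReal_pos (hy δ hδ).ne' (measure_ne_top _ _)
  have hc2 : Tendsto (fun τ : ℝ => L * (τ - t₀) ^ 2) (𝓝 t₀) (𝓝 0) := by
    have : Continuous (fun τ : ℝ => L * (τ - t₀) ^ 2) := by fun_prop
    have h2 := this.tendsto t₀
    simpa using h2
  obtain ⟨η, hη, hηs⟩ := Metric.eventually_nhds_iff.1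
    (hc2.eventually (gt_mem_nhds (by positivity : 0 < ε ^ 2 * p)))
  refine ⟨min η 1, by positivity, fun {τ} hτ hd => ?_⟩
  have hτ : 0 ≤ τ := hτ
  have hτ1 : τ ≤ t₀ + 1 := by
    have := hd.trans_le (min_le_right _ _)
    rw [Real.dist_eq] at this
    linarith [(abs_lt.1 this).2]
  by_contra! hcon
  rw [Real.dist_eq] at hcon
  have hlow : ∀ z ∈ msupp ρ, z ∈ Ioo (y - δ) (y + δ) → ε ^ 2 ≤ (X τ z - X t₀ z) ^ 2 := by
    intro z hz hzI
    have hzd : dist z y < δ := by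
      rw [Real.dist_eq, abs_lt]; constructor <;> linarith [hzI.1, hzI.2]
    have h1 := hδs hzd
    have h2 := hTm τ hτ z hz
    have h3 := hTm t₀ ht₀ z hz
    have h4 : τ * |T y - T z| ≤ (t₀ + 1) * |T y - T z| := by gcongr
    have h5 : t₀ * |T y - T z| ≤ (t₀ + 1) * |T y - T z| := by gcongr; linarith
    have h6 : |X τ y - X t₀ y| ≤ |X τ y - X τ z| + |X τ z - X t₀ z| + |X t₀ y - X t₀ z| := by
      have e : X τ y - X t₀ y = (X τ y - X τ z) + (X τ z - X t₀ z) - (X t₀ y - X t₀ z) := by ring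
      rw [e]
      exact (abs_sub _ _).trans (add_le_add (abs_add_le _ _) le_rfl)
    have h7 : ε ≤ |X τ z - X t₀ z| := by linarith
    rw [← sq_abs (X τ z - X t₀ z)]
    gcongr
  have hint : Integrable (fun z => (X τ z - X t₀ z) ^ 2) ρ :=
    ((h.iso τ hτ).mX.sub (h.iso t₀ ht₀).mX).integrable_sq
  have h1 := mul_meas_ge_le_integral_of_nonneg (μ := ρ) (ae_of_all _ fun z => sq_nonneg _) hint
    (ε ^ 2)
  have h2 : p ≤ ρ.real {z | ε ^ 2 ≤ (X τ z - X t₀ z) ^ 2} := by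
    rw [hp, measureReal_def, measureReal_def]
    refine ENNReal.toReal_mono (measure_ne_top _ _) (measure_mono_ae ?_)
    filter_upwards [ep_msupp_ae ρ] with z hz hzI
    exact hlow z hz hzI
  have h3 := hηs (hd.trans_le (min_le_left _ _))
  have h4 := hL t₀ τ ht₀ hτ
  have h5 : ε ^ 2 * p ≤ ε ^ 2 * ρ.real {z | ε ^ 2 ≤ (X τ z - X t₀ z) ^ 2} := by gcongr
  linarith

lemma ep_force_fix {ρ : Measure ℝ} [IsProbabilityMeasure ρ] {v T F : ℝ → ℝ} {X : ℝ → ℝ → ℝ}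
    (h : EPFam ρ v T F X) {s t : ℝ} (hs : 0 ≤ s) (hst : s ≤ t) {g : ℝ → ℝ} (hg : Continuous g)
    {M : ℝ} (hM : ∀ x, |g x| ≤ M) :
    ∫ y, g (X t y) * ∫ z, Real.sign (X s y - X s z) ∂ρ ∂ρ = ∫ y, g (X t y) * epF ρ y ∂ρ := by
  have hXs := (h.cont s).measurable
  have hXt := (h.cont t).measurable
  set k : ℝ × ℝ → ℝ := fun p => Real.sign (X s p.1 - X s p.2) - Real.sign (p.1 - p.2) with hk
  have hkm : Measurable k :=
    (ep_sign_meas.comp ((hXs.comp measurable_fst).sub (hXs.comp measurable_snd))).sub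
      (ep_sign_meas.comp (measurable_fst.sub measurable_snd))
  have hkb : ∀ p, ‖k p‖ ≤ 2 := by
    intro p
    have := (abs_sub (Real.sign (X s p.1 - X s p.2)) (Real.sign (p.1 - p.2)))
    rw [Real.norm_eq_abs]
    linarith [ep_sign_abs (X s p.1 - X s p.2), ep_sign_abs (p.1 - p.2)]
  have hg1 : Integrable (fun p : ℝ × ℝ => g (X t p.1) * k p) (ρ.prod ρ) := by
    refine Integrable.of_bound (C := M * 2)
      ((hg.measurable.comp (hXt.comp measurable_fst)).mul hkm).aestronglyMeasurable
      (ae_of_all _ fun p => ?_)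
    rw [norm_mul]
    exact mul_le_mul (hM _) (hkb p) (norm_nonneg _) ((abs_nonneg _).trans (hM 0))
  have hanti : ∀ p, k p.swap = - k p := by
    intro p
    simp only [hk, Prod.fst_swap, Prod.snd_swap]
    rw [← neg_sub (X s p.1), ← neg_sub p.1, Real.sign_neg, Real.sign_neg]
    ring
  have hI0 : ∫ p, g (X t p.1) * k p ∂(ρ.prod ρ) = 0 := by
    have e1 : ∫ p, g (X t p.1) * k p ∂(ρ.prod ρ) = ∫ p, - (g (X t p.2) * k p) ∂(ρ.prod ρ) := by
      rw [← integral_prod_swap]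
      congr 1; funext p
      rw [hanti, Prod.fst_swap]; ring
    have e2 : ∀ᵐ p ∂(ρ.prod ρ), g (X t p.1) * k p = g (X t p.2) * k p := by
      have m1 : ∀ᵐ p ∂(ρ.prod ρ), p.1 ∈ msupp ρ :=
        Measure.quasiMeasurePreserving_fst.ae (ep_msupp_ae ρ)
      have m2 : ∀ᵐ p ∂(ρ.prod ρ), p.2 ∈ msupp ρ :=
        Measure.quasiMeasurePreserving_snd.ae (ep_msupp_ae ρ)
      filter_upwards [m1, m2] with p h1 h2
      obtain ⟨φ, -, hφ⟩ := h.factor hs hst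
      by_cases hX : X s p.1 = X s p.2
      · rw [hφ _ h1, hφ _ h2, hX]
      · have : k p = 0 := by
          simp only [hk]
          rcases lt_trichotomy p.1 p.2 with hlt | heq | hlt
          · have := (h.two s hs _ h2 _ h1 hlt.le).1
            rw [Real.sign_of_neg (sub_neg.2 hlt), Real.sign_of_neg, sub_self]
            exact lt_of_le_of_ne (by linarith) (sub_ne_zero.2 hX)
          · exact absurd (by rw [heq]) hX
          · have := (h.two s hs _ h1 _ h2 hlt.le).1
            rw [Real.sign_of_pos (sub_pos.2 hlt), Real.sign_of_pos, sub_self]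
            exact lt_of_le_of_ne (by linarith) (sub_ne_zero.2 hX).symm
        rw [this, mul_zero, mul_zero]
    rw [integral_neg, ← integral_congr_ae e2] at e1
    linarith
  rw [integral_prod _ hg1] at hI0
  have e3 : ∀ y, ∫ z, g (X t y) * k (y, z) ∂ρ =
      g (X t y) * (∫ z, Real.sign (X s y - X s z) ∂ρ) - g (X t y) * epF ρ y := by
    intro y
    have i1 := ep_sign_int (ρ := ρ) (X s y) hXs
    have i2 : Integrable (fun z => Real.sign (y - z)) ρ := ep_sign_int y measurable_id
    rw [integral_const_mul, ← mul_sub, epF]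
    simp only [hk]
    rw [integral_sub i1 i2]
  have hA : StronglyMeasurable (fun y => ∫ z, Real.sign (X s y - X s z) ∂ρ) := by
    apply StronglyMeasurable.integral_prod_right'
      (f := fun p : ℝ × ℝ => Real.sign (X s p.1 - X s p.2))
    exact (ep_sign_meas.comp ((hXs.comp measurable_fst).sub
      (hXs.comp measurable_snd))).stronglyMeasurable
  have hgi : Integrable (fun y => g (X t y)) ρ :=
    Integrable.of_bound (C := M) (hg.comp (h.cont t)).aestronglyMeasurable
      (ae_of_all _ fun y => hM _)
  have j1 : Integrable (fun y => g (X t y) * ∫ z, Real.sign (X s y - X s z) ∂ρ) ρ := by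
    refine hgi.mul_bdd (c := 1) hA.aestronglyMeasurable (ae_of_all _ fun y => ?_)
    have := norm_integral_le_of_norm_le_const (μ := ρ)
      (f := fun z => Real.sign (X s y - X s z)) (C := 1)
      (ae_of_all _ fun z => by rw [Real.norm_eq_abs]; exact ep_sign_abs _)
    simpa using this
  have j2 : Integrable (fun y => g (X t y) * epF ρ y) ρ :=
    hgi.mul_bdd (c := 1) epF_mono.measurable.aestronglyMeasurable
      (ae_of_all _ fun y => by rw [Real.norm_eq_abs]; exact epF_abs _)
  simp only [e3] at hI0
  rw [integral_sub j1 j2] at hI0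
  linarith

lemma ep_force {ρ : Measure ℝ} [IsProbabilityMeasure ρ] {v T F : ℝ → ℝ} {X : ℝ → ℝ → ℝ}
    (hT : Continuous T) (hv : MemLp v 2 ρ) (h : EPFam ρ v T F X) {L : ℝ}
    (hL : ∀ s t, 0 ≤ s → 0 ≤ t → ∫ y, (X t y - X s y) ^ 2 ∂ρ ≤ L * (t - s) ^ 2)
    {t : ℝ} (ht : 0 ≤ t) {g : ℝ → ℝ} (hg : Continuous g) {M : ℝ} (hM : ∀ x, |g x| ≤ M) :
    ∫ y, g (X t y) * (v y - t * epF ρ y) ∂ρ =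
      ∫ y, g (X t y) * (v y - ∫ τ in (0:ℝ)..t, ∫ z, Real.sign (X τ y - X τ z) ∂ρ) ∂ρ := by
  classical
  have hne : (msupp ρ).Nonempty := by
    by_contra hemp
    have h1 := ep_msupp_ae ρ
    rw [not_nonempty_iff_eq_empty.1 hemp, mem_ae_iff, compl_empty, measure_univ] at h1
    exact one_ne_zero h1
  obtain ⟨y₀, hy₀⟩ := hne
  let qq : ℝ → ℝ := fun y => if y ∈ msupp ρ then y else y₀
  have hqm : Measurable qq := Measurable.ite (ep_msupp_meas ρ) measurable_id measurable_const
  have hqs : ∀ y, qq y ∈ msupp ρ := by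
    intro y
    by_cases hy : y ∈ msupp ρ <;> simp [qq, hy, hy₀]
  have hqe : ∀ y ∈ msupp ρ, qq y = y := fun y hy => by simp [qq, hy]
  let P : ℝ → ℝ → ℝ := fun τ y => X (max τ 0) (qq y)
  have hP : StronglyMeasurable (Function.uncurry P) := by
    apply stronglyMeasurable_uncurry_of_continuous_of_stronglyMeasurable
    · intro y
      exact (ep_time_cont hT h hL (hqs y)).comp_continuous (continuous_id.max continuous_const)
        (fun τ => mem_Ici.2 (le_max_right _ _))
    · intro τ
      exact ((h.cont _).measurable.comp hqm).stronglyMeasurable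
  let Q : ℝ × ℝ → ℝ := fun q => ∫ z, Real.sign (P q.2 q.1 - P q.2 z) ∂ρ
  have hQ : StronglyMeasurable Q := by
    apply StronglyMeasurable.integral_prod_right'
      (f := fun p : (ℝ × ℝ) × ℝ => Real.sign (P p.1.2 p.1.1 - P p.1.2 p.2))
    refine (ep_sign_meas.comp (Measurable.sub ?_ ?_)).stronglyMeasurable
    · exact hP.measurable.comp (measurable_fst.snd.prodMk measurable_fst.fst)
    · exact hP.measurable.comp (measurable_fst.snd.prodMk measurable_snd)
  have hQb : ∀ q, ‖Q q‖ ≤ 1 := by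
    intro q
    have := norm_integral_le_of_norm_le_const (μ := ρ)
      (f := fun z => Real.sign (P q.2 q.1 - P q.2 z)) (C := 1)
      (ae_of_all _ fun z => by rw [Real.norm_eq_abs]; exact ep_sign_abs _)
    simpa using this
  have hQe : ∀ y ∈ msupp ρ, ∀ τ, 0 ≤ τ → Q (y, τ) = ∫ z, Real.sign (X τ y - X τ z) ∂ρ := by
    intro y hy τ hτ
    apply integral_congr_ae
    filter_upwards [ep_msupp_ae ρ] with z hz
    simp only [P, hqe y hy, hqe z hz, max_eq_left hτ]
  have hXt := (h.cont t).measurable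
  have hJ : Integrable (fun q : ℝ × ℝ => g (X t q.1) * Q q) (ρ.prod (volume.restrict (Ioc 0 t))) := by
    refine Integrable.of_bound (C := M * 1)
      ((hg.measurable.comp (hXt.comp measurable_fst)).mul hQ.measurable).aestronglyMeasurable
      (ae_of_all _ fun p => ?_)
    rw [norm_mul]
    exact mul_le_mul (hM _) (hQb p) (norm_nonneg _) ((abs_nonneg _).trans (hM 0))
  have e1 : ∀ᵐ y ∂ρ, g (X t y) * ∫ τ in (0:ℝ)..t, ∫ z, Real.sign (X τ y - X τ z) ∂ρ =
      ∫ τ in Ioc 0 t, g (X t y) * Q (y, τ) := by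
    filter_upwards [ep_msupp_ae ρ] with y hy
    rw [intervalIntegral.integral_of_le ht, integral_const_mul]
    congr 1
    apply setIntegral_congr_fun measurableSet_Ioc
    intro τ hτ
    exact (hQe y hy τ hτ.1.le).symm
  have iB : Integrable (fun y => g (X t y) *
      ∫ τ in (0:ℝ)..t, ∫ z, Real.sign (X τ y - X τ z) ∂ρ) ρ :=
    hJ.integral_prod_left.congr (e1.mono fun y hy => hy.symm)
  have e2 : ∫ y, g (X t y) * (∫ τ in (0:ℝ)..t, ∫ z, Real.sign (X τ y - X τ z) ∂ρ) ∂ρ =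
      t * ∫ y, g (X t y) * epF ρ y ∂ρ := by
    rw [integral_congr_ae e1, integral_integral_swap (f := fun y τ => g (X t y) * Q (y, τ)) hJ]
    have e3 : ∀ τ ∈ Ioc 0 t, ∫ y, g (X t y) * Q (y, τ) ∂ρ = ∫ y, g (X t y) * epF ρ y ∂ρ := by
      intro τ hτ
      rw [← ep_force_fix h hτ.1.le hτ.2 hg hM]
      apply integral_congr_ae
      filter_upwards [ep_msupp_ae ρ] with y hy
      rw [hQe y hy τ hτ.1.le]
    rw [setIntegral_congr_fun measurableSet_Ioc e3, setIntegral_const]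
    simp [ht]
  have hgi : Integrable (fun y => g (X t y)) ρ :=
    Integrable.of_bound (C := M) (hg.comp (h.cont t)).aestronglyMeasurable
      (ae_of_all _ fun y => hM _)
  have iv : Integrable (fun y => g (X t y) * v y) ρ :=
    (hv.integrable (by norm_num)).bdd_mul (c := M) (hg.comp (h.cont t)).aestronglyMeasurable
      (ae_of_all _ fun y => hM _)
  have iF : Integrable (fun y => g (X t y) * epF ρ y) ρ :=
    hgi.mul_bdd (c := 1) epF_mono.measurable.aestronglyMeasurable
      (ae_of_all _ fun y => by rw [Real.norm_eq_abs]; exact epF_abs _)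
  have l1 : ∫ y, g (X t y) * (v y - t * epF ρ y) ∂ρ =
      (∫ y, g (X t y) * v y ∂ρ) - t * ∫ y, g (X t y) * epF ρ y ∂ρ := by
    rw [← integral_const_mul, ← integral_sub iv (iF.const_mul t)]
    congr 1; funext y; ring
  rw [l1, ← e2, ← integral_sub iv iB]
  congr 1; funext y; ring


/-- Theorem 1.2: existence of a trajectory map solving the Euler–Poisson
flow equation, with energy monotonicity, stability and quantitative stickiness. -/
theorem euler_poisson_flow_existence
    (ρ₀ : Measure ℝ) [IsProbabilityMeasure ρ₀]
    (hmom : Integrable (fun x => x ^ 2) ρ₀)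
    (v₀ v₀' : ℝ → ℝ)
    (hv₀'loc : LocallyIntegrable v₀' volume)
    (hv₀ : ∀ a b : ℝ, v₀ b - v₀ a = ∫ x in a..b, v₀' x) :
    ∃ X V : ℝ → ℝ → ℝ,
      -- continuous representative at each time
      (∀ t, 0 ≤ t → Continuous (X t)) ∧
      -- X(t) ∈ L²(ρ₀)
      (∀ t, 0 ≤ t → Integrable (fun y => (X t y) ^ 2) ρ₀) ∧
      -- X : [0,∞) → L²(ρ₀) is (globally) Lipschitz
      (∃ L : ℝ, ∀ s t : ℝ, 0 ≤ s → 0 ≤ t →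
        ∫ y, (X t y - X s y) ^ 2 ∂ρ₀ ≤ L * (t - s) ^ 2) ∧
      -- initial condition X(0) = id ρ₀-a.e.
      (∀ᵐ y ∂ρ₀, X 0 y = y) ∧
      -- Euler–Poisson flow equation for a.e. t ≥ 0:
      (∀ᵐ t ∂(volume.restrict (Ici (0:ℝ))),
        HasL2DerivAt ρ₀ X (V t) t ∧
        (∀ g : ℝ → ℝ, Continuous g → (∃ M, ∀ x, |g x| ≤ M) →
          ∫ y, g (X t y) * V t y ∂ρ₀ =
            ∫ y, g (X t y) *
              (v₀ y - ∫ τ in (0:ℝ)..t, ∫ z, Real.sign (X τ y - X τ z) ∂ρ₀) ∂ρ₀) ∧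
        (∃ u : ℝ → ℝ, Measurable u ∧ ∀ᵐ y ∂ρ₀, V t y = u (X t y))) ∧
      -- (i) energy nonincreasing for a.e. s ≤ t
      (∃ N : Set ℝ, volume N = 0 ∧ ∀ s ∉ N, ∀ t ∉ N, 0 ≤ s → s ≤ t →
        (∫ y, (1/2) * (V t y) ^ 2 ∂ρ₀) +
          (∫ y, ∫ z, (1/2) * |X t y - X t z| ∂ρ₀ ∂ρ₀) ≤
        (∫ y, (1/2) * (V s y) ^ 2 ∂ρ₀) +
          (∫ y, ∫ z, (1/2) * |X s y - X s z| ∂ρ₀ ∂ρ₀)) ∧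
      -- (ii) monotonicity and stability estimate on supp(ρ₀)
      (∀ t, 0 ≤ t → ∀ y ∈ msupp ρ₀, ∀ z ∈ msupp ρ₀, z ≤ y →
        0 ≤ X t y - X t z ∧
        X t y - X t z ≤ (y - z) + t * ∫ x in z..y, |v₀' x|) ∧
      -- (iii) quantitative stickiness
      (∀ s t : ℝ, 0 < s → s ≤ t → ∀ y ∈ msupp ρ₀, ∀ z ∈ msupp ρ₀,
        (1 / t) * |X t y - X t z| ≤ (1 / s) * |X s y - X s z|) := by
  classical
  have hii : ∀ a b : ℝ, IntervalIntegrable v₀' volume a b := fun a b =>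
    (hv₀'loc.integrableOn_isCompact isCompact_uIcc).intervalIntegrable
  have hia : ∀ a b : ℝ, IntervalIntegrable (fun x => |v₀' x|) volume a b := fun a b =>
    (hii a b).abs
  have hvc : Continuous v₀ := by
    have h1 : v₀ = fun b => v₀ 0 + ∫ x in (0:ℝ)..b, v₀' x := by
      funext b; rw [← hv₀ 0 b]; ring
    rw [h1]
    exact continuous_const.add (intervalIntegral.continuous_primitive hii 0)
  set T : ℝ → ℝ := fun y => ∫ x in (0:ℝ)..y, |v₀' x| with hT
  have hTd : ∀ y z, T y - T z = ∫ x in z..y, |v₀' x| := fun y z =>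
    intervalIntegral.integral_interval_sub_left (hia 0 y) (hia 0 z)
  have hTc : Continuous T := intervalIntegral.continuous_primitive hia 0
  have hTm : Monotone T := by
    intro z y hzy
    have h1 : 0 ≤ ∫ x in z..y, |v₀' x| :=
      intervalIntegral.integral_nonneg hzy fun x _ => abs_nonneg _
    rw [← hTd] at h1
    linarith
  have hTv : Monotone (fun x => T x - v₀ x) := by
    intro z y hzy
    have h1 : ∫ x in z..y, v₀' x ≤ ∫ x in z..y, |v₀' x| :=
      intervalIntegral.integral_mono_on hzy (hii z y) (hia z y) fun x _ => le_abs_self _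
    rw [← hTd, ← hv₀] at h1
    simp only
    linarith
  have hid : MemLp (fun x : ℝ => x) 2 ρ₀ :=
    (memLp_two_iff_integrable_sq measurable_id.aestronglyMeasurable).2 hmom
  by_cases hL2 : MemLp v₀ 2 ρ₀
  · have hd : EPData ρ₀ v₀ T (epF ρ₀) := ⟨hid, hL2, epF_mem, epF_mono, hTm, hTc, hTv⟩
    obtain ⟨X, hX⟩ := hd.fam
    obtain ⟨V, L, N, hN, hL, hder, hu, ha, hen⟩ := ep_flow hd hX
    refine ⟨X, fun t => V t, fun t _ => hX.cont t, fun t ht => (hX.iso t ht).mX.integrable_sq,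
      ⟨L, hL⟩, ?_, ?_, ⟨∅, measure_empty, fun s _ t _ hs hst => hen s t hs hst⟩, ?_, ?_⟩
    · rw [hX.zero]
      exact ae_of_all _ fun _ => rfl
    · have h1 : ∀ᵐ t ∂(volume.restrict (Ici (0:ℝ))), t ∉ insert (0:ℝ) N :=
        ae_restrict_of_ae (measure_eq_zero_iff_ae_notMem.1 ((hN.insert 0).measure_zero volume))
      filter_upwards [h1, ae_restrict_mem measurableSet_Ici] with t ht ht0
      rw [mem_insert_iff, not_or] at ht
      have ht0 : 0 ≤ t := ht0
      refine ⟨hder t ht0 ht.1 ht.2, ?_, hu t ht0⟩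
      rintro g hg ⟨M, hM⟩
      rw [ha t ht0 g hg ⟨M, hM⟩]
      exact ep_force hTc hL2 hX hL ht0 hg hM
    · intro t ht y hy z hz hzy
      have := hX.two t ht y hy z hz hzy
      rwa [hTd] at this
    · intro s t hs hst y hy z hz
      have ht : 0 < t := hs.trans_le hst
      have key : ∀ y ∈ msupp ρ₀, ∀ z ∈ msupp ρ₀, z ≤ y →
          (1 / t) * |X t y - X t z| ≤ (1 / s) * |X s y - X s z| := by
        intro y hy z hz hzy
        have h1 := hX.three s t hs hst y hy z hz hzy
        rw [abs_of_nonneg (hX.two t ht.le y hy z hz hzy).1,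
          abs_of_nonneg (hX.two s hs.le y hy z hz hzy).1]
        have h2 := mul_le_mul_of_nonneg_left h1 (by positivity : 0 ≤ 1 / t)
        refine h2.trans (le_of_eq ?_)
        field_simp
      rcases le_total z y with hzy | hzy
      · exact key y hy z hz hzy
      · rw [abs_sub_comm, abs_sub_comm (X s y)]
        exact key z hz y hy hzy
  · -- here `v₀` is not square integrable and the velocity integrals have their default value
    have hVm : ∀ t : ℝ, Measurable (fun y => v₀ y - t * epF ρ₀ y) := fun t =>
      hvc.measurable.sub (epF_mono.measurable.const_mul t)
    have hV0 : ∀ t : ℝ, ∫ y, (v₀ y - t * epF ρ₀ y) ^ 2 ∂ρ₀ = 0 := by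
      intro t
      apply integral_undef
      intro hi
      have h1 := (memLp_two_iff_integrable_sq (hVm t).aestronglyMeasurable).2 hi
      apply hL2
      have h2 := h1.add ((epF_mem (ρ := ρ₀)).const_mul t)
      refine h2.ae_eq (ae_of_all _ fun y => ?_)
      simp
    refine ⟨fun _ y => y, fun t y => v₀ y - t * epF ρ₀ y, fun _ _ => continuous_id,
      fun _ _ => hmom, ⟨0, fun s t _ _ => by simp⟩, ae_of_all _ fun _ => rfl, ?_,
      ⟨∅, measure_empty, fun s _ t _ _ _ => ?_⟩, ?_, ?_⟩
    · refine ae_of_all _ fun t => ⟨?_, ?_, ⟨_, hVm t, ae_of_all _ fun _ => rfl⟩⟩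
      · simp only [HasL2DerivAt, sub_self, zero_div, zero_sub, neg_sq, hV0]
        exact tendsto_const_nhds
      · intro g _ _
        congr 1; funext y
        rw [intervalIntegral.integral_const, smul_eq_mul, sub_zero]
        rfl
    · simp only [integral_const_mul, hV0]
      exact le_rfl
    · intro t ht y _ z _ hzy
      refine ⟨sub_nonneg.2 hzy, ?_⟩
      have h1 := mul_nonneg ht (sub_nonneg.2 (hTm hzy))
      rw [hTd] at h1
      linarith
    · intro s t hs hst y _ z _
      have : 1 / t ≤ 1 / s := one_div_le_one_div_of_le hs hst
      exact mul_le_mul_of_nonneg_right this (abs_nonneg _)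

end
end

section
/- Let (ε_k)_{k∈ℕ} be positive numbers with ε_k → 0, and set W'_ε(x) := x/(x² + ε²)^{1/2}. Let (μ^k)_{k∈ℕ} be Borel probability measures on ℝ converging narrowly to μ with lim_{k→∞} ∫ x² dμ^k(x) = ∫ x² dμ(x) < ∞. Then for every continuous g: ℝ → ℝ with sup_x |g(x)|/(1+|x|) < ∞, lim_{k→∞} ∫∫ W'_{ε_k}(x − y) g(x) dμ^k(x) dμ^k(y) = ∫∫ sgn(x − y) g(x) dμ(x) dμ(y). -/
open MeasureTheory Real Filter Set Topology

noncomputable section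

def Wsm (e d : ℝ) : ℝ := d / Real.sqrt (d ^ 2 + e ^ 2)

def Hsm (g : ℝ → ℝ) (e x y : ℝ) : ℝ := Wsm e (x - y) * (g x - g y)

lemma Wsm_abs_le (e d : ℝ) : |Wsm e d| ≤ 1 := by
  unfold Wsm
  rw [abs_div, abs_of_nonneg (Real.sqrt_nonneg _)]
  apply div_le_one_of_le₀ _ (Real.sqrt_nonneg _)
  apply Real.abs_le_sqrt
  nlinarith [sq_nonneg e]

lemma Wsm_zero (d : ℝ) : Wsm 0 d = Real.sign d := by
  unfold Wsm
  have : Real.sqrt (d ^ 2 + 0 ^ 2) = |d| := by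
    rw [← Real.sqrt_sq_eq_abs]; congr 1; ring
  rw [this]
  rcases lt_trichotomy d 0 with h | h | h
  · rw [Real.sign_of_neg h, abs_of_neg h, div_neg, div_self h.ne]
  · subst h; simp
  · rw [Real.sign_of_pos h, abs_of_pos h, div_self h.ne']

lemma Wsm_neg (e d : ℝ) : Wsm e (-d) = - Wsm e d := by
  unfold Wsm
  rw [neg_sq, neg_div]

lemma Wsm_measurable (e : ℝ) : Measurable (Wsm e) := by
  unfold Wsm
  fun_prop

lemma Hsm_abs_le (g : ℝ → ℝ) (e x y : ℝ) : |Hsm g e x y| ≤ |g x - g y| := by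
  unfold Hsm
  rw [abs_mul]
  exact mul_le_of_le_one_left (abs_nonneg _) (Wsm_abs_le _ _)

lemma Hsm_continuous (g : ℝ → ℝ) (hg : Continuous g) :
    Continuous (fun q : ℝ × (ℝ × ℝ) => Hsm g q.1 q.2.1 q.2.2) := by
  rw [continuous_iff_continuousAt]
  rintro ⟨e, x, y⟩
  by_cases h : (x - y) ^ 2 + e ^ 2 = 0
  · have hxy : x = y := by nlinarith [sq_nonneg (x - y), sq_nonneg e]
    subst hxy
    have h0 : Hsm g e x x = 0 := by simp [Hsm]
    unfold ContinuousAt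
    simp only [h0]
    apply squeeze_zero_norm (a := fun q : ℝ × (ℝ × ℝ) => |g q.2.1 - g q.2.2|)
    · intro q
      exact Hsm_abs_le g _ _ _
    · have : Continuous (fun q : ℝ × (ℝ × ℝ) => |g q.2.1 - g q.2.2|) := by fun_prop
      simpa using this.tendsto (e, x, x)
  · unfold Hsm Wsm
    apply ContinuousAt.mul
    · apply ContinuousAt.div
      · fun_prop
      · fun_prop
      · have : 0 < (x - y) ^ 2 + e ^ 2 := lt_of_le_of_ne (by positivity) (Ne.symm h)
        exact (Real.sqrt_pos.2 this).ne'
    · fun_prop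

lemma integrable_g (ν : Measure ℝ) [IsProbabilityMeasure ν]
    (hν : Integrable (fun x => x ^ 2) ν) (g : ℝ → ℝ) (hg : Continuous g) (C : ℝ) (hC : 0 ≤ C)
    (hgC : ∀ x, |g x| ≤ C * (1 + |x|)) : Integrable g ν := by
  have : Integrable (fun x : ℝ => C * (2 + x ^ 2)) ν :=
    ((integrable_const 2).add hν).const_mul C
  refine this.mono' hg.aestronglyMeasurable (ae_of_all _ fun x => ?_)
  refine (hgC x).trans (mul_le_mul_of_nonneg_left ?_ hC)
  nlinarith [sq_nonneg (|x| - 1), sq_abs x]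

lemma Hsm_integrable (ν : Measure ℝ) [IsProbabilityMeasure ν]
    (g : ℝ → ℝ) (hg : Continuous g) (hi : Integrable g ν) (e : ℝ) :
    Integrable (fun p : ℝ × ℝ => Hsm g e p.1 p.2) (ν.prod ν) := by
  have h1 : Integrable (fun p : ℝ × ℝ => |g p.1 - g p.2|) (ν.prod ν) :=
    ((hi.comp_fst ν).sub (hi.comp_snd ν)).abs
  refine h1.mono' ?_ (ae_of_all _ fun p => Hsm_abs_le g _ _ _)
  exact ((Hsm_continuous g hg).comp (by fun_prop : Continuous fun p : ℝ × ℝ => (e, p))).aestronglyMeasurable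

lemma symm_formula (ν : Measure ℝ) [IsProbabilityMeasure ν]
    (g : ℝ → ℝ) (hg : Continuous g) (hi : Integrable g ν) (e : ℝ) :
    ∫ y, ∫ x, Wsm e (x - y) * g x ∂ν ∂ν = 1 / 2 * ∫ p, Hsm g e p.1 p.2 ∂(ν.prod ν) := by
  set F : ℝ × ℝ → ℝ := fun p => Wsm e (p.1 - p.2) * g p.1 with hF
  have hFi : Integrable F (ν.prod ν) := by
    refine (hi.comp_fst ν).norm.mono' ?_ (ae_of_all _ fun p => ?_)
    · have := Wsm_measurable e
      have := hg.measurable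
      exact Measurable.aestronglyMeasurable (by fun_prop)
    · rw [hF, norm_mul]
      exact mul_le_of_le_one_left (norm_nonneg _) (Wsm_abs_le _ _)
  have h1 : ∫ p, Hsm g e p.1 p.2 ∂(ν.prod ν)
      = ∫ p, F p ∂(ν.prod ν) + ∫ p, F p.swap ∂(ν.prod ν) := by
    have hsw : Integrable (fun p : ℝ × ℝ => F p.swap) (ν.prod ν) := hFi.swap
    rw [← integral_add hFi hsw]
    congr 1
    ext p
    simp only [hF, Hsm, Prod.fst_swap, Prod.snd_swap, Function.comp]
    rw [← neg_sub p.1 p.2, Wsm_neg]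
    ring
  rw [h1, integral_prod_swap, integral_prod_symm F hFi]
  ring

def clampR (R x : ℝ) : ℝ := max (-R) (min R x)

lemma clampR_abs_le (R x : ℝ) (hR : 0 ≤ R) : |clampR R x| ≤ R := by
  unfold clampR
  rw [abs_le]
  exact ⟨le_max_left _ _, max_le (by linarith) (min_le_left _ _)⟩

lemma clampR_abs_le' (R x : ℝ) (hR : 0 ≤ R) : |clampR R x| ≤ |x| := by
  unfold clampR
  rw [abs_le]
  refine ⟨?_, max_le (by linarith [abs_nonneg x]) ((min_le_right _ _).trans (le_abs_self x))⟩
  rcases le_total R x with h | h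
  · rw [min_eq_left h]; exact le_max_of_le_right (by linarith [abs_nonneg x])
  · rw [min_eq_right h]; exact le_max_of_le_right (neg_abs_le x)

lemma clampR_eq (R x : ℝ) (h : |x| ≤ R) : clampR R x = x := by
  unfold clampR
  rw [abs_le] at h
  rw [min_eq_right h.2, max_eq_right h.1]

lemma clampR_continuous (R : ℝ) : Continuous (clampR R) := by
  unfold clampR
  fun_prop

lemma Hsm_growth (g : ℝ → ℝ) (C : ℝ)
    (hgC : ∀ x, |g x| ≤ C * (1 + |x|)) (e x y : ℝ) :
    |Hsm g e x y| ≤ C * (2 + |x| + |y|) := by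
  have := Hsm_abs_le g e x y
  have := abs_sub (g x) (g y)
  linarith [hgC x, hgC y]

lemma Hsm_tail (g : ℝ → ℝ) (C : ℝ) (hC : 0 ≤ C)
    (hgC : ∀ x, |g x| ≤ C * (1 + |x|)) (R : ℝ) (hR : 1 ≤ R) (e x y : ℝ) :
    |Hsm g e x y - Hsm g e (clampR R x) (clampR R y)| ≤ 8 * C / R * (x ^ 2 + y ^ 2) := by
  by_cases h : |x| ≤ R ∧ |y| ≤ R
  · rw [clampR_eq R x h.1, clampR_eq R y h.2, sub_self, abs_zero]
    positivity
  · have h1 := Hsm_growth g C hgC e x y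
    have h2 := Hsm_growth g C hgC e (clampR R x) (clampR R y)
    have h3 : C * (2 + |clampR R x| + |clampR R y|) ≤ C * (2 + |x| + |y|) := by
      have := clampR_abs_le' R x (by linarith)
      have := clampR_abs_le' R y (by linarith)
      gcongr
    have h4 := abs_sub (Hsm g e x y) (Hsm g e (clampR R x) (clampR R y))
    have h5 : (2 + |x| + |y|) * R ≤ 4 * (x ^ 2 + y ^ 2) := by
      rw [← sq_abs x, ← sq_abs y]
      have hx := abs_nonneg x
      have hy := abs_nonneg y
      generalize |x| = a at *
      generalize |y| = b at *
      have key : ∀ s t : ℝ, 0 ≤ t → t ≤ s → R < s → (2 + s + t) * R ≤ 4 * (s ^ 2 + t ^ 2) := by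
        intro s t ht hts hRs
        nlinarith [mul_nonneg (by linarith : (0:ℝ) ≤ s - R) (by linarith : (0:ℝ) ≤ s)]
      rcases le_total a b with hab | hab
      · have hb : R < b := by
          by_contra hcon
          exact h ⟨by linarith, by linarith⟩
        linarith [key b a hx hab hb]
      · have hb : R < a := by
          by_contra hcon
          exact h ⟨by linarith, by linarith⟩
        linarith [key a b hy hab hb]
    have h6 : 2 + |x| + |y| ≤ 4 * (x ^ 2 + y ^ 2) / R := by
      rw [le_div_iff₀ (by linarith)]; exact h5
    have h7 := mul_le_mul_of_nonneg_left h6 hC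
    have h8 : 8 * C / R * (x ^ 2 + y ^ 2) = 2 * (C * (4 * (x ^ 2 + y ^ 2) / R)) := by ring
    rw [h8]
    linarith

lemma Hclamp_continuous (g : ℝ → ℝ) (hg : Continuous g) (R : ℝ) :
    Continuous (fun q : ℝ × (ℝ × ℝ) => Hsm g q.1 (clampR R q.2.1) (clampR R q.2.2)) := by
  have := clampR_continuous R
  exact (Hsm_continuous g hg).comp
    (by fun_prop : Continuous fun q : ℝ × (ℝ × ℝ) => (q.1, (clampR R q.2.1, clampR R q.2.2)))

lemma Hclamp_bound (g : ℝ → ℝ) (C : ℝ) (hC : 0 ≤ C)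
    (hgC : ∀ x, |g x| ≤ C * (1 + |x|)) (R : ℝ) (hR : 1 ≤ R) (e x y : ℝ) :
    |Hsm g e (clampR R x) (clampR R y)| ≤ C * (2 + R + R) := by
  refine (Hsm_growth g C hgC _ _ _).trans ?_
  have := clampR_abs_le R x (by linarith)
  have := clampR_abs_le R y (by linarith)
  gcongr

lemma Hclamp_integrable (ν : Measure ℝ) [IsProbabilityMeasure ν]
    (g : ℝ → ℝ) (hg : Continuous g) (C : ℝ) (hC : 0 ≤ C)
    (hgC : ∀ x, |g x| ≤ C * (1 + |x|)) (R : ℝ) (hR : 1 ≤ R) (e : ℝ) :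
    Integrable (fun p : ℝ × ℝ => Hsm g e (clampR R p.1) (clampR R p.2)) (ν.prod ν) := by
  refine (integrable_const (C * (2 + R + R))).mono' ?_
    (ae_of_all _ fun p => Hclamp_bound g C hC hgC R hR e _ _)
  exact ((Hclamp_continuous g hg R).comp
    (by fun_prop : Continuous fun p : ℝ × ℝ => (e, p))).aestronglyMeasurable

lemma tail_integral (ν : Measure ℝ) [IsProbabilityMeasure ν]
    (hν : Integrable (fun x => x ^ 2) ν)
    (g : ℝ → ℝ) (hg : Continuous g) (C : ℝ) (hC : 0 ≤ C)
    (hgC : ∀ x, |g x| ≤ C * (1 + |x|)) (R : ℝ) (hR : 1 ≤ R) (e : ℝ) :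
    |∫ p, Hsm g e p.1 p.2 ∂(ν.prod ν) - ∫ p, Hsm g e (clampR R p.1) (clampR R p.2) ∂(ν.prod ν)|
      ≤ 16 * C / R * ∫ x, x ^ 2 ∂ν := by
  have hi := integrable_g ν hν g hg C hC hgC
  rw [← integral_sub (Hsm_integrable ν g hg hi e) (Hclamp_integrable ν g hg C hC hgC R hR e)]
  have hf := hν.comp_fst ν
  have hs := hν.comp_snd ν
  have h := norm_integral_le_of_norm_le (μ := ν.prod ν)
    (f := fun p : ℝ × ℝ => Hsm g e p.1 p.2 - Hsm g e (clampR R p.1) (clampR R p.2)) ((hf.add hs).const_mul (8 * C / R))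
    (ae_of_all _ fun p => Hsm_tail g C hC hgC R hR e p.1 p.2)
  refine h.trans (le_of_eq ?_)
  have h2 : ∫ p : ℝ × ℝ, (p.1 ^ 2 + p.2 ^ 2) ∂(ν.prod ν) = 2 * ∫ x, x ^ 2 ∂ν := by
    rw [integral_add hf hs, integral_fun_fst (fun x : ℝ => x ^ 2),
      integral_fun_snd (fun x : ℝ => x ^ 2)]
    simp
    ring
  rw [integral_const_mul]
  simp only [Pi.add_apply]
  rw [h2]
  ring

lemma clamp_tendsto
    (ε : ℕ → ℝ) (hε0 : Tendsto ε atTop (𝓝 0))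
    (μk : ℕ → Measure ℝ) (μ : Measure ℝ)
    [∀ k, IsProbabilityMeasure (μk k)] [IsProbabilityMeasure μ]
    (hnarrow : ∀ f : ℝ → ℝ, Continuous f → (∃ M, ∀ x, |f x| ≤ M) →
      Tendsto (fun k => ∫ x, f x ∂μk k) atTop (𝓝 (∫ x, f x ∂μ)))
    (g : ℝ → ℝ) (hg : Continuous g) (C : ℝ) (hC : 0 ≤ C)
    (hgC : ∀ x, |g x| ≤ C * (1 + |x|)) (R : ℝ) (hR : 1 ≤ R) :
    Tendsto (fun k => ∫ p, Hsm g (ε k) (clampR R p.1) (clampR R p.2) ∂((μk k).prod (μk k))) atTop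
      (𝓝 (∫ p, Hsm g 0 (clampR R p.1) (clampR R p.2) ∂(μ.prod μ))) := by
  let P : ℕ → ProbabilityMeasure ℝ := fun k => ⟨μk k, inferInstance⟩
  let Q : ProbabilityMeasure ℝ := ⟨μ, inferInstance⟩
  have hP : Tendsto P atTop (𝓝 Q) := by
    rw [ProbabilityMeasure.tendsto_iff_forall_integral_tendsto]
    intro f
    exact hnarrow f f.continuous ⟨‖f‖, fun x => f.norm_coe_le_norm x⟩
  have hPP : Tendsto (fun k => (P k).prod (P k)) atTop (𝓝 (Q.prod Q)) :=
    (ProbabilityMeasure.continuous_prod.tendsto (Q, Q)).comp (hP.prodMk_nhds hP)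
  have hD : Tendsto (fun k => diracProba (ε k)) atTop (𝓝 (diracProba (0:ℝ))) :=
    (continuous_diracProba.tendsto (0:ℝ)).comp hε0
  have hT : Tendsto (fun k => (diracProba (ε k)).prod ((P k).prod (P k))) atTop
      (𝓝 ((diracProba (0:ℝ)).prod (Q.prod Q))) :=
    (ProbabilityMeasure.continuous_prod.tendsto (diracProba (0:ℝ), Q.prod Q)).comp
      (hD.prodMk_nhds hPP)
  rw [ProbabilityMeasure.tendsto_iff_forall_integral_tendsto] at hT
  let f : BoundedContinuousFunction (ℝ × (ℝ × ℝ)) ℝ :=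
    BoundedContinuousFunction.ofNormedAddCommGroup _ (Hclamp_continuous g hg R) (C * (2 + R + R))
      (fun q => Hclamp_bound g C hC hgC R hR _ _ _)
  have key : ∀ (e : ℝ) (ν : Measure ℝ) [IsProbabilityMeasure ν],
      ∫ q, f q ∂((Measure.dirac e).prod (ν.prod ν))
        = ∫ p, Hsm g e (clampR R p.1) (clampR R p.2) ∂(ν.prod ν) := by
    intro e ν _
    rw [integral_prod _ (f.integrable _), integral_dirac]
    rfl
  have := hT f
  rw [← key]
  refine this.congr fun k => ?_
  rw [← key]
  rfl


/-- Lemma 5.3: convergence of the smoothed interaction terms.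
Here `W'_ε(x) = x/(x² + ε²)^{1/2}` is the derivative of `W_ε(x) = (x²+ε²)^{1/2}`. -/
theorem smoothed_sgn_convergence
    (ε : ℕ → ℝ) (hε : ∀ k, 0 < ε k) (hε0 : Tendsto ε atTop (𝓝 0))
    (μk : ℕ → Measure ℝ) (μ : Measure ℝ)
    [∀ k, IsProbabilityMeasure (μk k)] [IsProbabilityMeasure μ]
    (hmom : Integrable (fun x => x ^ 2) μ)
    (hmomk : ∀ k, Integrable (fun x => x ^ 2) (μk k))
    -- narrow convergence μ^k → μ
    (hnarrow : ∀ f : ℝ → ℝ, Continuous f → (∃ M, ∀ x, |f x| ≤ M) →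
      Tendsto (fun k => ∫ x, f x ∂μk k) atTop (𝓝 (∫ x, f x ∂μ)))
    -- convergence of second moments
    (hmomconv : Tendsto (fun k => ∫ x, x ^ 2 ∂μk k) atTop (𝓝 (∫ x, x ^ 2 ∂μ)))
    (g : ℝ → ℝ) (hg : Continuous g)
    (hggrowth : ∃ C : ℝ, ∀ x, |g x| ≤ C * (1 + |x|)) :
    Tendsto
      (fun k => ∫ y, ∫ x,
        (x - y) / Real.sqrt ((x - y) ^ 2 + (ε k) ^ 2) * g x ∂μk k ∂μk k)
      atTop
      (𝓝 (∫ y, ∫ x, Real.sign (x - y) * g x ∂μ ∂μ)) := by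
  obtain ⟨C, hgC⟩ := hggrowth
  have hC : 0 ≤ C := by
    have := (abs_nonneg _).trans (hgC 0)
    simpa using this
  have hL : ∀ k, ∫ y, ∫ x,
        (x - y) / Real.sqrt ((x - y) ^ 2 + (ε k) ^ 2) * g x ∂μk k ∂μk k
      = 1 / 2 * ∫ p, Hsm g (ε k) p.1 p.2 ∂((μk k).prod (μk k)) := fun k =>
    symm_formula (μk k) g hg (integrable_g _ (hmomk k) g hg C hC hgC) (ε k)
  have hR : ∫ y, ∫ x, Real.sign (x - y) * g x ∂μ ∂μ
      = 1 / 2 * ∫ p, Hsm g 0 p.1 p.2 ∂(μ.prod μ) := by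
    rw [← symm_formula μ g hg (integrable_g _ hmom g hg C hC hgC) 0]
    simp only [Wsm_zero]
  simp only [hL, hR]
  apply Tendsto.const_mul
  rw [Metric.tendsto_atTop']
  intro η hη
  set M := ∫ x, x ^ 2 ∂μ + 1 with hM
  have hMpos : 0 < M := by
    have : 0 ≤ ∫ x, x ^ 2 ∂μ := integral_nonneg fun x => sq_nonneg x
    linarith
  obtain ⟨R, hR1, hRη⟩ : ∃ R : ℝ, 1 ≤ R ∧ 16 * C / R * M < η / 3 := by
    refine ⟨max 1 (16 * C * M * 3 / η + 1), le_max_left _ _, ?_⟩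
    have h1 : 16 * C * M * 3 / η + 1 ≤ max 1 (16 * C * M * 3 / η + 1) := le_max_right _ _
    have h0 : (1:ℝ) ≤ max 1 (16 * C * M * 3 / η + 1) := le_max_left _ _
    generalize max 1 (16 * C * M * 3 / η + 1) = R at *
    have h2 : 16 * C * M * 3 / η < R := by linarith
    rw [div_lt_iff₀ hη] at h2
    rw [div_mul_eq_mul_div, div_lt_iff₀ (by linarith)]
    linarith
  have hcl := clamp_tendsto ε hε0 μk μ hnarrow g hg C hC hgC R hR1
  have e1 := (Metric.tendsto_nhds.1 hcl) (η / 3) (by positivity)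
  have e2 : ∀ᶠ k in atTop, ∫ x, x ^ 2 ∂μk k < M := hmomconv.eventually_lt_const (by linarith)
  have e3 : ∀ᶠ k in atTop, dist (∫ p, Hsm g (ε k) p.1 p.2 ∂((μk k).prod (μk k)))
      (∫ p, Hsm g 0 p.1 p.2 ∂(μ.prod μ)) < η := by
    filter_upwards [e1, e2] with k h1 h2
    have t1 := tail_integral (μk k) (hmomk k) g hg C hC hgC R hR1 (ε k)
    have t2 := tail_integral μ hmom g hg C hC hgC R hR1 0
    have c0 : 0 ≤ 16 * C / R := by positivity
    have u1 := mul_le_mul_of_nonneg_left h2.le c0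
    have u2 := mul_le_mul_of_nonneg_left (by linarith : ∫ x, x ^ 2 ∂μ ≤ M) c0
    rw [Real.dist_eq, abs_lt] at *
    rw [abs_le] at t1 t2
    constructor <;> linarith [h1.1, h1.2, t1.1, t1.2, t2.1, t2.2]
  obtain ⟨N, hN⟩ := eventually_atTop.1 e3
  exact ⟨N, fun n hn => hN n hn.le⟩

end
end
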